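/- For every ε > 0, for all sufficiently large primes p, the number of positive integers n ≤ p^{1/4} with (n|p) = −1 differs from (1/2)p^{1/4} by at most ε·p^{1/4}; that is, #{n ≤ p^{1/4} : (n|p) = −1} = (1/2 + o(1))·p^{1/4} as p → ∞. -/

import Mathlib

open Polynomial

/-- If `X ^ p` divides `r + s f ^ ((p - 1) / 2)` with `r`, `s` of small degree and `f` has a root of
odd multiplicity, then `r = s = 0`. -/
theorem eq_zero_of_X_pow_dvd_add_mul_pow {p : ℕ} [Fact p.Prime] {g m c : ℕ} (hg : 2 * g + 1 = p)
    {f r s : (ZMod p)[X]} (hf : f.natDegree ≤ m) (hf0 : f.coeff 0 ≠ 0) {a : ZMod p}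
    (ha : Odd (f.rootMultiplicity a)) (hr : r.degree < c) (hs : s.degree < c)
    (hc : 2 * c + m < p) (h : X ^ p ∣ r + s * f ^ g) : r = 0 ∧ s = 0 := by
  have hf1 : f ≠ 0 := by rintro rfl; simp at hf0
  have hrn : r.natDegree ≤ c := natDegree_le_iff_degree_le.2 hr.le
  have hsn : s.natDegree ≤ c := natDegree_le_iff_degree_le.2 hs.le
  have hfp : X ^ p ∣ f ^ p - C (f.coeff 0) := by
    have h1 : (X : (ZMod p)[X]) ∣ f - C (f.coeff 0) := by
      rw [X_dvd_iff]; simp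
    have h2 := map_dvd (expand (ZMod p) p) h1
    rwa [map_sub, expand_X, expand_C, ZMod.expand_card] at h2
  have h2 : X ^ p ∣ r ^ 2 * f - s ^ 2 * C (f.coeff 0) := by
    have e : r ^ 2 * f - s ^ 2 * C (f.coeff 0) =
        (r + s * f ^ g) * ((r - s * f ^ g) * f) + s ^ 2 * (f ^ p - C (f.coeff 0)) := by
      have e1 : f ^ p = f ^ g * f ^ g * f := by
        rw [← pow_add, ← pow_succ]
        congr 1
        omega
      rw [e1]; ring
    rw [e]
    exact dvd_add (Dvd.dvd.mul_right h _) (Dvd.dvd.mul_left hfp _)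
  have h3 : r ^ 2 * f - s ^ 2 * C (f.coeff 0) = 0 := by
    by_contra hne
    have h4 := natDegree_le_of_dvd h2 hne
    rw [natDegree_X_pow] at h4
    have h5 : (r ^ 2 * f - s ^ 2 * C (f.coeff 0)).natDegree ≤ 2 * c + m := by
      refine (natDegree_sub_le _ _).trans (max_le ?_ ?_)
      · refine natDegree_mul_le.trans (add_le_add (natDegree_pow_le.trans ?_) hf)
        omega
      · refine natDegree_mul_le.trans ?_
        rw [natDegree_C]
        have := (natDegree_pow_le (p := s) (n := 2))
        omega
    omega
  have h4 : r * r * f = s * s * C (f.coeff 0) := by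
    rw [sub_eq_zero] at h3; rw [← pow_two, ← pow_two, h3]
  have hC : C (f.coeff 0) ≠ 0 := by simpa using hf0
  by_cases hr0 : r = 0
  · refine ⟨hr0, ?_⟩
    rw [hr0] at h4
    simpa [hf0] using h4.symm
  · exfalso
    have hne : r * r * f ≠ 0 := mul_ne_zero (mul_ne_zero hr0 hr0) hf1
    have hne' := hne
    rw [h4] at hne'
    have e1 : rootMultiplicity a (r * r * f) = rootMultiplicity a (s * s * C (f.coeff 0)) := by
      rw [h4]
    rw [rootMultiplicity_mul hne, rootMultiplicity_mul hne',
      rootMultiplicity_mul (left_ne_zero_of_mul hne),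
      rootMultiplicity_mul (left_ne_zero_of_mul hne'), rootMultiplicity_C] at e1
    obtain ⟨t, ht⟩ := ha
    omega

theorem forall_eq_zero_of_sum_add_mul_pow_eq_zero {p : ℕ} [Fact p.Prime] {g m c : ℕ}
    (hg : 2 * g + 1 = p) {f : (ZMod p)[X]} (hf : f.natDegree ≤ m) (hf0 : f.coeff 0 ≠ 0)
    {a : ZMod p} (ha : Odd (f.rootMultiplicity a)) (hc : 2 * c + m < p) (J : ℕ)
    (r s : ℕ → (ZMod p)[X]) (hr : ∀ j, (r j).degree < c) (hs : ∀ j, (s j).degree < c)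
    (h : ∑ j ∈ Finset.range J, (r j + s j * f ^ g) * (X ^ p) ^ j = 0) :
    ∀ j < J, r j = 0 ∧ s j = 0 := by
  induction J generalizing r s with
  | zero => intro j hj; omega
  | succ J ih =>
    rw [Finset.sum_range_succ'] at h
    have e : ∑ k ∈ Finset.range J, (r (k + 1) + s (k + 1) * f ^ g) * (X ^ p) ^ (k + 1) =
        X ^ p * ∑ k ∈ Finset.range J, (r (k + 1) + s (k + 1) * f ^ g) * (X ^ p) ^ k := by
      rw [Finset.mul_sum]
      refine Finset.sum_congr rfl fun k _ => ?_
      ring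
    rw [e, pow_zero, mul_one] at h
    have h0 : X ^ p ∣ r 0 + s 0 * f ^ g := by
      rw [eq_neg_of_add_eq_zero_right h]
      exact (dvd_mul_right _ _).neg_right
    have h1 := eq_zero_of_X_pow_dvd_add_mul_pow hg hf hf0 ha (hr 0) (hs 0) hc h0
    rw [h1.1, h1.2, zero_mul, add_zero, add_zero] at h
    have h2 := (mul_eq_zero.1 h).resolve_left (pow_ne_zero _ X_ne_zero)
    have h3 := ih (fun k => r (k + 1)) (fun k => s (k + 1)) (fun k => hr _) (fun k => hs _) h2
    intro j hj
    rcases j with _ | j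
    · exact h1
    · exact h3 j (by omega)

/-- The operator with `derivative (f ^ (n + 1) * r) = f ^ n * powMulDerivative f n r`. -/
noncomputable def powMulDerivative {K : Type*} [Field K] (f : K[X]) (n : ℕ) : K[X] →ₗ[K] K[X] :=
  LinearMap.mulLeft K ((n + 1 : K[X]) * derivative f) + LinearMap.mulLeft K f ∘ₗ derivative

/-- The operator with
`derivative^[k] (f ^ (n + k) * r) = f ^ n * iteratedPowMulDerivative f n k r`. -/
noncomputable def iteratedPowMulDerivative {K : Type*} [Field K] (f : K[X]) (n : ℕ) :
    ℕ → (K[X] →ₗ[K] K[X])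
  | 0 => LinearMap.id
  | k + 1 => iteratedPowMulDerivative f n k ∘ₗ powMulDerivative f (n + k)

theorem derivative_pow_mul {K : Type*} [Field K] (f r : K[X]) (n : ℕ) :
    derivative (f ^ (n + 1) * r) = f ^ n * powMulDerivative f n r := by
  simp [powMulDerivative, derivative_mul, derivative_pow]
  ring

theorem iterate_derivative_pow_mul {K : Type*} [Field K] (f : K[X]) (n k : ℕ) (r : K[X]) :
    derivative^[k] (f ^ (n + k) * r) = f ^ n * iteratedPowMulDerivative f n k r := by
  induction k generalizing r with
  | zero => simp [iteratedPowMulDerivative]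
  | succ k ih =>
    rw [Function.iterate_succ_apply, ← add_assoc, derivative_pow_mul, ih]
    simp [iteratedPowMulDerivative]

theorem natDegree_powMulDerivative_le {K : Type*} [Field K] (f r : K[X]) (n : ℕ) :
    (powMulDerivative f n r).natDegree ≤ r.natDegree + f.natDegree := by
  simp only [powMulDerivative, LinearMap.add_apply, LinearMap.mulLeft_apply, LinearMap.comp_apply]
  refine (natDegree_add_le _ _).trans (max_le ?_ ?_)
  · have h1 : ((n + 1 : K[X])) = C ((n : K) + 1) := by simp
    rw [h1, mul_assoc]
    refine (natDegree_C_mul_le _ _).trans (natDegree_mul_le.trans ?_)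
    have := natDegree_derivative_le f
    omega
  · refine natDegree_mul_le.trans ?_
    have := natDegree_derivative_le r
    omega

theorem natDegree_iteratedPowMulDerivative_le {K : Type*} [Field K] (f : K[X]) (n k : ℕ)
    (r : K[X]) :
    (iteratedPowMulDerivative f n k r).natDegree ≤ r.natDegree + k * f.natDegree := by
  induction k generalizing r with
  | zero => simp [iteratedPowMulDerivative]
  | succ k ih =>
    simp only [iteratedPowMulDerivative, LinearMap.comp_apply]
    refine (ih _).trans ?_
    have := natDegree_powMulDerivative_le f r (n + k)
    linarith

theorem iterate_derivative_mul_X_pow_char {p : ℕ} [Fact p.Prime] (q : (ZMod p)[X]) (j k : ℕ) :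
    derivative^[k] (q * (X ^ p) ^ j) = derivative^[k] q * (X ^ p) ^ j := by
  induction k generalizing q with
  | zero => simp
  | succ k ih =>
    rw [Function.iterate_succ_apply, Function.iterate_succ_apply, ← ih]
    congr 1
    simp [derivative_mul, derivative_pow]

/-- Polynomials of degree less than `c`, parametrised by their coefficients. -/
noncomputable def polyOfCoeffs (K : Type*) [Field K] (c : ℕ) : (Fin c → K) →ₗ[K] K[X] :=
  (degreeLT K c).subtype ∘ₗ (degreeLTEquiv K c).symm.toLinearMap

theorem degree_polyOfCoeffs_lt {K : Type*} [Field K] {c : ℕ} (v : Fin c → K) :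
    (polyOfCoeffs K c v).degree < c :=
  mem_degreeLT.1 ((degreeLTEquiv K c).symm v).2

theorem polyOfCoeffs_injective (K : Type*) [Field K] (c : ℕ) :
    Function.Injective (polyOfCoeffs K c) := by
  intro v w h
  simpa [polyOfCoeffs] using h

theorem natDegree_polyOfCoeffs_le {K : Type*} [Field K] {c : ℕ} (v : Fin c → K) :
    (polyOfCoeffs K c v).natDegree ≤ c := by
  rw [natDegree_le_iff_degree_le]
  exact (degree_polyOfCoeffs_lt v).le

/-- Stepanov's auxiliary polynomial: the linear algebra step. -/
theorem exists_aux_coeffs {K : Type*} [Field K] (f : K[X]) (g m c l J : ℕ)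
    (hf : f.natDegree ≤ m) (hdim : l * (c + l * m + J) < 2 * (J * c)) :
    ∃ v w : Fin J → Fin c → K, (v ≠ 0 ∨ w ≠ 0) ∧ ∀ k < l,
      ∑ j, (iteratedPowMulDerivative f (l - k) k (polyOfCoeffs K c (v j)) +
        iteratedPowMulDerivative f (l - k + g) k (polyOfCoeffs K c (w j))) * X ^ (j : ℕ) = 0 := by
  let E : ℕ → ((Fin J → Fin c → K) × (Fin J → Fin c → K)) →ₗ[K] K[X] := fun k =>
    ∑ j : Fin J, LinearMap.mulRight K (X ^ (j : ℕ)) ∘ₗ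
      (iteratedPowMulDerivative f (l - k) k ∘ₗ polyOfCoeffs K c ∘ₗ LinearMap.proj j ∘ₗ
          LinearMap.fst K _ _ +
        iteratedPowMulDerivative f (l - k + g) k ∘ₗ polyOfCoeffs K c ∘ₗ LinearMap.proj j ∘ₗ
          LinearMap.snd K _ _)
  have hE : ∀ k v w, E k (v, w) =
      ∑ j, (iteratedPowMulDerivative f (l - k) k (polyOfCoeffs K c (v j)) +
        iteratedPowMulDerivative f (l - k + g) k (polyOfCoeffs K c (w j))) * X ^ (j : ℕ) := by
    intro k v w
    simp [E, LinearMap.sum_apply]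
  let Φ : ((Fin J → Fin c → K) × (Fin J → Fin c → K)) →ₗ[K] (Fin l → Fin (c + l * m + J) → K) :=
    LinearMap.pi fun k => LinearMap.pi fun i => lcoeff K i ∘ₗ E k
  have hker : LinearMap.ker Φ ≠ ⊥ := by
    apply LinearMap.ker_ne_bot_of_finrank_lt
    simp [Module.finrank_pi_fintype, Module.finrank_prod]
    linarith
  obtain ⟨⟨v, w⟩, hmem, hne⟩ := (Submodule.ne_bot_iff _).1 hker
  refine ⟨v, w, ?_, fun k hk => ?_⟩
  · by_contra hcon
    push Not at hcon
    exact hne (by rw [hcon.1, hcon.2]; rfl)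
  · rw [← hE]
    have hb : ∀ (n : ℕ) (u : Fin c → K), (iteratedPowMulDerivative f n k
        (polyOfCoeffs K c u)).natDegree ≤ c + l * m := by
      intro n u
      refine (natDegree_iteratedPowMulDerivative_le f n k _).trans ?_
      have := natDegree_polyOfCoeffs_le u
      have := Nat.mul_le_mul hk.le hf
      omega
    ext i
    by_cases hi : i < c + l * m + J
    · have := congrFun (congrFun (LinearMap.mem_ker.1 hmem) ⟨k, hk⟩) ⟨i, hi⟩
      simpa [Φ] using this
    · rw [coeff_zero, hE, finsetSum_coeff]
      refine Finset.sum_eq_zero fun j _ => coeff_eq_zero_of_natDegree_lt ?_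
      refine lt_of_le_of_lt (natDegree_mul_le.trans (add_le_add ((natDegree_add_le _ _).trans
        (max_le (hb _ _) (hb _ _))) (natDegree_X_pow_le _))) ?_
      have := j.2
      omega

theorem mul_card_le_natDegree_of_le_rootMultiplicity {K : Type*} [Field K] [DecidableEq K]
    {R : K[X]} (T : Finset K) (l : ℕ)
    (h : ∀ x ∈ T, l ≤ R.rootMultiplicity x) : l * T.card ≤ R.natDegree := by
  refine le_trans ?_ (card_roots' R)
  have h1 : l • T.val ≤ R.roots := by
    rw [Multiset.le_iff_count]
    intro x
    rw [Multiset.count_nsmul, count_roots]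
    by_cases hx : x ∈ T
    · have := Multiset.nodup_iff_count_le_one.1 T.nodup x
      exact le_trans (by nlinarith) (h x hx)
    · rw [Multiset.count_eq_zero_of_notMem (by simpa using hx)]
      simp
  have := Multiset.card_le_card h1
  simpa using this

/-- Stepanov's bound, with free parameters. -/
theorem stepanov_mul_card_le {p : ℕ} [Fact p.Prime] {g m c l J : ℕ} (hg : 2 * g + 1 = p)
    {f : (ZMod p)[X]} (hf : f.natDegree ≤ m) (hf0 : f.coeff 0 ≠ 0) {a : ZMod p}
    (ha : Odd (f.rootMultiplicity a)) (hc : 2 * c + m < p) (hl : l ≤ p)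
    (hdim : l * (c + l * m + J) < 2 * (J * c)) :
    l * (Finset.univ.filter fun x : ZMod p => f.eval x ^ g = 1).card ≤
      l * m + c + g * m + J * p := by
  classical
  obtain ⟨v, w, hvw, hk⟩ := exists_aux_coeffs f g m c l J hf hdim
  have hf1 : f ≠ 0 := by rintro rfl; simp at hf0
  let P := polyOfCoeffs (ZMod p) c
  let R : (ZMod p)[X] := ∑ j : Fin J, (P (v j) + P (w j) * f ^ g) * (X ^ p) ^ (j : ℕ)
  have hR0 : R ≠ 0 := by
    intro h0
    let r : ℕ → (ZMod p)[X] := fun j => if hj : j < J then P (v ⟨j, hj⟩) else 0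
    let s : ℕ → (ZMod p)[X] := fun j => if hj : j < J then P (w ⟨j, hj⟩) else 0
    have hr : ∀ j, (r j).degree < c := by
      intro j
      by_cases hj : j < J
      · simpa [r, hj] using degree_polyOfCoeffs_lt _
      · simp [r, hj]
    have hs : ∀ j, (s j).degree < c := by
      intro j
      by_cases hj : j < J
      · simpa [s, hj] using degree_polyOfCoeffs_lt _
      · simp [s, hj]
    have hsum : ∑ j ∈ Finset.range J, (r j + s j * f ^ g) * (X ^ p) ^ j = 0 := by
      rw [Finset.sum_range, ← h0]
      refine Finset.sum_congr rfl fun j _ => ?_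
      simp [r, s]
    have h2 := forall_eq_zero_of_sum_add_mul_pow_eq_zero hg hf hf0 ha hc J r s hr hs hsum
    rcases hvw with h | h <;> refine h (funext fun j => polyOfCoeffs_injective _ _ ?_)
    · simpa [r, P] using (h2 j j.2).1
    · simpa [s, P] using (h2 j j.2).2
  have hdeg : (f ^ l * R).natDegree ≤ l * m + c + g * m + J * p := by
    have h1 : R.natDegree ≤ c + g * m + J * p := by
      refine natDegree_sum_le_of_forall_le _ _ fun j _ => ?_
      refine natDegree_mul_le.trans (add_le_add ?_ ?_)
      · refine (natDegree_add_le _ _).trans (max_le ?_ ?_)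
        · exact (natDegree_polyOfCoeffs_le _).trans (by omega)
        · refine natDegree_mul_le.trans (add_le_add (natDegree_polyOfCoeffs_le _) ?_)
          exact natDegree_pow_le.trans (Nat.mul_le_mul_left _ hf)
      · rw [← pow_mul, natDegree_X_pow, mul_comm]
        exact Nat.mul_le_mul_right _ j.2.le
    have h2 : (f ^ l).natDegree ≤ l * m := natDegree_pow_le.trans (Nat.mul_le_mul_left _ hf)
    have := natDegree_mul_le (p := f ^ l) (q := R)
    omega
  refine (mul_card_le_natDegree_of_le_rootMultiplicity
    _ l fun x hx => ?_).trans hdeg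
  have hx1 : f.eval x ^ g = 1 := by simpa using hx
  rcases l with _ | l
  · exact Nat.zero_le _
  refine lt_rootMultiplicity_of_isRoot_iterate_derivative_of_mem_nonZeroDivisors
    (mul_ne_zero (pow_ne_zero _ hf1) hR0) (fun k hkl => ?_) ?_
  · have e1 : f ^ (l + 1) * R = ∑ j : Fin J, ((f ^ (l + 1 - k + k) * P (v j)) +
        f ^ (l + 1 - k + g + k) * P (w j)) * (X ^ p) ^ (j : ℕ) := by
      rw [show l + 1 - k + k = l + 1 by omega, show l + 1 - k + g + k = l + 1 + g by omega]
      rw [Finset.mul_sum]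
      refine Finset.sum_congr rfl fun j _ => ?_
      ring
    have h2 := congrArg (eval x) (hk k (by omega))
    rw [IsRoot, e1, iterate_derivative_sum, eval_finsetSum]
    rw [eval_finsetSum, eval_zero] at h2
    have h3 : ∀ j : Fin J, eval x (derivative^[k] (((f ^ (l + 1 - k + k) * P (v j)) +
        f ^ (l + 1 - k + g + k) * P (w j)) * (X ^ p) ^ (j : ℕ))) =
        eval x f ^ (l + 1 - k) * eval x ((iteratedPowMulDerivative f (l + 1 - k) k
          (polyOfCoeffs (ZMod p) c (v j)) + iteratedPowMulDerivative f (l + 1 - k + g) k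
          (polyOfCoeffs (ZMod p) c (w j))) * X ^ (j : ℕ)) := by
      intro j
      rw [iterate_derivative_mul_X_pow_char, iterate_map_add, iterate_derivative_pow_mul,
        iterate_derivative_pow_mul]
      simp only [eval_mul, eval_add, eval_pow, eval_X, ZMod.pow_card, pow_add _ _ g, hx1, P]
      ring
    rw [Finset.sum_congr rfl fun j _ => h3 j, ← Finset.mul_sum, h2, mul_zero]
  · rw [mem_nonZeroDivisors_iff_ne_zero, Ne, ZMod.natCast_eq_zero_iff,
      (Fact.out : p.Prime).dvd_factorial]
    omega

theorem stepanov_card_le {p : ℕ} [Fact p.Prime] {g m : ℕ} (hg : 2 * g + 1 = p)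
    {f : (ZMod p)[X]} (hf : f.natDegree ≤ m) (hf0 : f.coeff 0 ≠ 0) {a : ZMod p}
    (ha : Odd (f.rootMultiplicity a)) (hp : 16 * (m + 2) ^ 2 ≤ p) :
    ((Finset.univ.filter fun x : ZMod p => f.eval x ^ g = 1).card : ℝ) ≤
      p / 2 + (7 * m + 8) * √p := by
  obtain ⟨l, hl⟩ : ∃ l, l = Nat.sqrt p := ⟨_, rfl⟩
  have hl1 : l * l ≤ p := hl ▸ Nat.sqrt_le p
  have hl2 : p < (l + 1) * (l + 1) := hl ▸ Nat.lt_succ_sqrt p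
  have hl3 : 4 * (m + 2) ≤ l := by
    rw [hl, Nat.le_sqrt]
    linarith
  obtain ⟨c, hc1, hc2⟩ : ∃ c, 2 * c + m < p ∧ p ≤ 2 * c + m + 2 := by
    have : m + 2 ≤ p := by nlinarith
    exact ⟨(p - m - 1) / 2, by omega, by omega⟩
  obtain ⟨J, hJ1, hJ2⟩ : ∃ J, l + 4 * m + 5 ≤ 2 * J ∧ 2 * J ≤ l + 4 * m + 6 :=
    ⟨l / 2 + 2 * m + 3, by omega, by omega⟩
  have hdim : l * (c + l * m + J) < 2 * (J * c) := by
    have h1 : (l + 4 * m + 5) * c ≤ 2 * J * c := Nat.mul_le_mul_right _ hJ1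
    have h2 : l * (2 * J) ≤ l * (l + 4 * m + 6) := Nat.mul_le_mul_left _ hJ2
    have h3 : l * l * m ≤ p * m := Nat.mul_le_mul_right _ hl1
    have h4 : (4 * m + 5) * p ≤ (4 * m + 5) * (2 * c + m + 2) := Nat.mul_le_mul_left _ hc2
    have h5 : l * (4 * (m + 2)) ≤ l * l := Nat.mul_le_mul_left _ hl3
    nlinarith
  have hlp : l ≤ p := by nlinarith
  have h := stepanov_mul_card_le hg hf hf0 ha hc1 hlp hdim
  set N := (Finset.univ.filter fun x : ZMod p => f.eval x ^ g = 1).card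
  have h' : (l : ℝ) * N ≤ l * m + c + g * m + J * p := by exact_mod_cast h
  have hl0 : (8 : ℝ) ≤ l := by exact_mod_cast (by omega : 8 ≤ l)
  have hc' : (2 : ℝ) * c ≤ p := by exact_mod_cast (by omega : 2 * c ≤ p)
  have hg' : (2 : ℝ) * g ≤ p := by exact_mod_cast (by omega : 2 * g ≤ p)
  have hJ' : (2 : ℝ) * J ≤ l + 4 * m + 6 := by exact_mod_cast hJ2
  have hl2' : √(p : ℝ) ≤ l + 1 := by
    rw [Real.sqrt_le_left (by positivity)]
    have : (p : ℝ) < (l + 1) * (l + 1) := by exact_mod_cast hl2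
    nlinarith
  have hs : √(p : ℝ) * √(p : ℝ) = p := Real.mul_self_sqrt (by positivity)
  have hls : (l : ℝ) ≤ √(p : ℝ) := by
    apply Real.le_sqrt_of_sq_le
    have : (l : ℝ) * l ≤ p := by exact_mod_cast hl1
    nlinarith
  have hm : (0 : ℝ) ≤ m := Nat.cast_nonneg _
  have hp0 : (0 : ℝ) ≤ p := Nat.cast_nonneg _
  have hpl : (p : ℝ) ≤ 2 * √(p : ℝ) * l := by nlinarith
  have h6 : (l : ℝ) * N ≤ l * (p / 2 + (7 * m + 8) * √p) := by
    have e1 : (g : ℝ) * m ≤ p / 2 * m := by nlinarith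
    have e2 : (J : ℝ) * p ≤ (l + 4 * m + 6) / 2 * p := by nlinarith
    have e3 : (p : ℝ) * (5 * m + 7) ≤ 2 * √(p : ℝ) * l * (5 * m + 7) :=
      mul_le_mul_of_nonneg_right hpl (by positivity)
    have e4 : (l : ℝ) * m * 1 ≤ l * m * √(p : ℝ) :=
      mul_le_mul_of_nonneg_left (by linarith) (by positivity)
    have e5 : 0 ≤ (l : ℝ) * m * √(p : ℝ) := by positivity
    have e6 : 0 ≤ (l : ℝ) * √(p : ℝ) := by positivity
    nlinarith
  exact le_of_mul_le_mul_left h6 (by linarith)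

theorem abs_sum_quadraticChar_le_of_coeff_zero {p : ℕ} [Fact p.Prime] {m : ℕ}
    {f : (ZMod p)[X]} (hf : f.natDegree ≤ m) (hf0 : f.coeff 0 ≠ 0) {a : ZMod p}
    (ha : Odd (f.rootMultiplicity a)) (hp : 16 * (m + 2) ^ 2 ≤ p) :
    |∑ x : ZMod p, (quadraticChar (ZMod p) (f.eval x) : ℝ)| ≤ (16 * m + 16) * √p := by
  have hp2 : p ≠ 2 := by rintro rfl; nlinarith
  have hchar : ringChar (ZMod p) ≠ 2 := by rwa [ZMod.ringChar_zmod_n]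
  obtain ⟨g, hg⟩ := (Fact.out : p.Prime).eq_two_or_odd'.resolve_left hp2
  have hg' : p / 2 = g := by omega
  have hpow : ∀ b : ZMod p, ((quadraticChar (ZMod p) b : ℤ) : ZMod p) = b ^ g := by
    intro b
    rw [quadraticChar_eq_pow_of_char_ne_two' hchar, ZMod.card, hg']
  have hneg : (-1 : ZMod p) ≠ 1 := by
    have : Fact (2 < p) := ⟨lt_of_le_of_ne (Fact.out : p.Prime).two_le hp2.symm⟩
    exact ZMod.neg_one_ne_one
  have hf1 : f ≠ 0 := by rintro rfl; simp at hf0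
  have hone : ∀ b : ZMod p, b ^ g = 1 ↔ quadraticChar (ZMod p) b = 1 := by
    intro b
    rw [← hpow]
    rcases quadraticChar_isQuadratic (ZMod p) b with h | h | h <;> rw [h] <;> simp [hneg]
  have hmone : ∀ b : ZMod p, b ^ g = -1 ↔ quadraticChar (ZMod p) b = -1 := by
    intro b
    rw [← hpow]
    rcases quadraticChar_isQuadratic (ZMod p) b with h | h | h <;> rw [h] <;>
      simp [hneg.symm]
  have hzero : ∀ b : ZMod p, quadraticChar (ZMod p) b = 0 ↔ b = 0 := fun b =>
    quadraticChar_eq_zero_iff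
  obtain ⟨u, hu⟩ := quadraticChar_exists_neg_one hchar
  have hu0 : u ≠ 0 := by rintro rfl; simp at hu
  set A := Finset.univ.filter fun x : ZMod p => f.eval x ^ g = 1 with hA
  set B := Finset.univ.filter fun x : ZMod p => f.eval x ^ g = -1 with hB
  set Z := Finset.univ.filter fun x : ZMod p => f.eval x = 0 with hZ
  have h1 : (A.card : ℝ) ≤ p / 2 + (7 * m + 8) * √p := stepanov_card_le hg.symm hf hf0 ha hp
  have h2 : (B.card : ℝ) ≤ p / 2 + (7 * m + 8) * √p := by
    have e : B = Finset.univ.filter fun x : ZMod p => (C u * f).eval x ^ g = 1 := by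
      rw [hB]
      refine Finset.filter_congr fun x _ => ?_
      rw [eval_mul, eval_C, mul_pow, (hmone u).2 hu]
      constructor
      · intro h; rw [h]; ring
      · intro h; rw [← h]; ring
    rw [e]
    refine stepanov_card_le (a := a) hg.symm ((natDegree_C_mul_le _ _).trans hf) ?_ ?_ hp
    · simpa [hu0] using hf0
    · rw [rootMultiplicity_mul (mul_ne_zero (by simpa using hu0) hf1), rootMultiplicity_C]
      simpa using ha
  have h3 : Z.card ≤ m := by
    refine le_trans ?_ ((card_roots' f).trans hf)
    refine le_trans (Finset.card_le_card (t := f.roots.toFinset) ?_) (Multiset.toFinset_card_le _)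
    intro x hx
    simp only [hZ, Finset.mem_filter, Finset.mem_univ, true_and] at hx
    simp [hf1, hx]
  have hval : ∀ x : ZMod p, (quadraticChar (ZMod p) (f.eval x) : ℝ) =
      (if f.eval x ^ g = 1 then 1 else 0) - (if f.eval x ^ g = -1 then 1 else 0) := by
    intro x
    simp only [hone, hmone]
    rcases quadraticChar_isQuadratic (ZMod p) (f.eval x) with h | h | h <;> rw [h] <;> norm_num
  have hcard : ∀ x : ZMod p, (1 : ℕ) = (if f.eval x ^ g = 1 then 1 else 0) +
      (if f.eval x ^ g = -1 then 1 else 0) + (if f.eval x = 0 then 1 else 0) := by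
    intro x
    simp only [hone, hmone, ← hzero]
    rcases quadraticChar_isQuadratic (ZMod p) (f.eval x) with h | h | h <;> rw [h] <;> norm_num
  have hsum : ∑ x : ZMod p, (quadraticChar (ZMod p) (f.eval x) : ℝ) = A.card - B.card := by
    rw [Finset.sum_congr rfl fun x _ => hval x, Finset.sum_sub_distrib]
    simp [hA, hB]
  have htot : p = A.card + B.card + Z.card := by
    have := Finset.sum_congr (rfl : (Finset.univ : Finset (ZMod p)) = Finset.univ)
      fun x _ => hcard x
    rw [Finset.sum_add_distrib, Finset.sum_add_distrib] at this
    simpa [hA, hB, hZ, ZMod.card] using this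
  have htot' : (p : ℝ) = A.card + B.card + Z.card := by exact_mod_cast htot
  have h3' : (Z.card : ℝ) ≤ m := by exact_mod_cast h3
  have hs1 : 1 ≤ √(p : ℝ) := by
    rw [Real.one_le_sqrt]
    exact_mod_cast (Fact.out : p.Prime).one_lt.le
  have hm : (m : ℝ) * 1 ≤ m * √(p : ℝ) := mul_le_mul_of_nonneg_left hs1 (Nat.cast_nonneg _)
  rw [hsum, abs_le]
  constructor <;> nlinarith

/-- Weil's bound for the quadratic character, with an unspecified dependence on the degree. -/
theorem abs_sum_quadraticChar_le {p : ℕ} [Fact p.Prime] {m : ℕ}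
    {f : (ZMod p)[X]} (hf : f.natDegree ≤ m) {a : ZMod p}
    (ha : Odd (f.rootMultiplicity a)) (hp : 16 * (m + 2) ^ 2 ≤ p) :
    |∑ x : ZMod p, (quadraticChar (ZMod p) (f.eval x) : ℝ)| ≤ (16 * m + 16) * √p := by
  have hf1 : f ≠ 0 := by rintro rfl; simp at ha
  obtain ⟨t, ht⟩ : ∃ t : ZMod p, f.eval t ≠ 0 := by
    by_contra hcon
    push Not at hcon
    refine hf1 (eq_zero_of_natDegree_lt_card_of_eval_eq_zero f (f := id) Function.injective_id
      (fun t => hcon t) ?_)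
    rw [ZMod.card]
    nlinarith
  have h := abs_sum_quadraticChar_le_of_coeff_zero (f := f.comp (X + C t)) (m := m) (a := a - t)
    ?_ ?_ ?_ hp
  · rw [← Equiv.sum_comp (Equiv.addRight t)]
    simpa using h
  · simpa [natDegree_comp] using hf
  · simpa [coeff_zero_eq_eval_zero] using ht
  · rw [rootMultiplicity_eq_rootMultiplicity] at ha ⊢
    rw [comp_assoc]
    convert ha using 3
    simp [add_assoc]

theorem rootMultiplicity_prod_X_add_C {K : Type*} [Field K] [DecidableEq K] {ι : Type*}
    (s : Finset ι) (b : ι → K) (v : K) :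
    (∏ i ∈ s, (X + C (b i))).rootMultiplicity (-v) = (s.filter fun i => b i = v).card := by
  classical
  induction s using Finset.induction_on with
  | empty => simp
  | insert i s hi ih =>
    have h0 : ∀ k, (X + C (b k)) ≠ 0 := fun k => X_add_C_ne_zero _
    rw [Finset.prod_insert hi, rootMultiplicity_mul
      (mul_ne_zero (h0 i) (Finset.prod_ne_zero_iff.2 fun k _ => h0 k)), ih, Finset.filter_insert]
    have h1 : (X + C (b i)) = X - C (-b i) := by simp
    rw [h1, rootMultiplicity_X_sub_C]
    by_cases h : b i = v
    · rw [if_pos h, if_pos (by rw [h]), Finset.card_insert_of_notMem (by simp [hi])]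
      ring
    · rw [if_neg h, if_neg (by simpa using fun h' => h h'.symm)]
      simp

/-- Tuples in which every value is attained an even number of times are rare. -/
theorem card_tuples_even_fibers_le (s : Finset ℕ) {r : ℕ} (hr : 0 < r) :
    ((Fintype.piFinset fun _ : Fin (2 * r) => s).filter fun b =>
      ∀ v ∈ s, Even (Finset.univ.filter fun i => b i = v).card).card ≤ r ^ (2 * r) * s.card ^ r := by
  classical
  have hsub : ((Fintype.piFinset fun _ : Fin (2 * r) => s).filter fun b =>
      ∀ v ∈ s, Even (Finset.univ.filter fun i => b i = v).card) ⊆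
      ((Finset.univ : Finset (Fin (2 * r) → Fin r)) ×ˢ (Fintype.piFinset fun _ : Fin r => s)).image
        fun hg => hg.2 ∘ hg.1 := by
    intro b hb
    rw [Finset.mem_filter, Fintype.mem_piFinset] at hb
    obtain ⟨hbs, hev⟩ := hb
    let t := Finset.univ.image b
    have hts : ∀ v ∈ t, v ∈ s := by
      intro v hv
      obtain ⟨i, -, rfl⟩ := Finset.mem_image.1 hv
      exact hbs i
    have hcard : t.card ≤ r := by
      have h1 : 2 * r = ∑ v ∈ t, (Finset.univ.filter fun i => b i = v).card := by
        rw [← Finset.card_eq_sum_card_image]; simp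
      have h2 : ∑ v ∈ t, 2 ≤ ∑ v ∈ t, (Finset.univ.filter fun i => b i = v).card := by
        refine Finset.sum_le_sum fun v hv => ?_
        obtain ⟨k, hk⟩ := hev v (hts v hv)
        obtain ⟨i, -, hi⟩ := Finset.mem_image.1 hv
        have : 0 < (Finset.univ.filter fun i => b i = v).card :=
          Finset.card_pos.2 ⟨i, by simp [hi]⟩
        omega
      rw [← h1] at h2
      simp at h2
      omega
    have hmem : ∀ i, b i ∈ t := fun i => Finset.mem_image_of_mem _ (Finset.mem_univ i)
    have : Nonempty t := ⟨⟨b ⟨0, by omega⟩, hmem _⟩⟩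
    obtain ⟨e⟩ : Nonempty (t ↪ Fin r) :=
      Function.Embedding.nonempty_of_card_le (by simpa using hcard)
    refine Finset.mem_image.2 ⟨(fun i => e ⟨b i, hmem i⟩, fun j => (Function.invFun e j : t)),
      ?_, ?_⟩
    · simp only [Finset.mem_product, Finset.mem_univ, true_and, Fintype.mem_piFinset]
      exact fun j => hts _ (Function.invFun e j).2
    · funext i
      simp [Function.leftInverse_invFun e.injective _]
  refine (Finset.card_le_card hsub).trans (Finset.card_image_le.trans ?_)
  simp

theorem abs_quadraticChar_le_one {F : Type*} [Field F] [Fintype F] [DecidableEq F] (a : F) :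
    |(quadraticChar F a : ℝ)| ≤ 1 := by
  rcases quadraticChar_isQuadratic F a with h | h | h <;> rw [h] <;> norm_num

theorem sum_pow_sum_quadraticChar_le {p : ℕ} [Fact p.Prime] {r B : ℕ} (hr : 0 < r) (hB : B < p)
    (hp : 16 * (2 * r + 2) ^ 2 ≤ p) :
    ∑ x : ZMod p, (∑ b ∈ Finset.Icc 1 B, (quadraticChar (ZMod p) (x + (b : ZMod p)) : ℝ)) ^ (2 * r)
      ≤ r ^ (2 * r) * B ^ r * p + B ^ (2 * r) * ((32 * r + 16) * √p) := by
  classical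
  set s := Finset.Icc 1 B with hs
  have hsc : s.card = B := by simp [hs]
  set P := Fintype.piFinset fun _ : Fin (2 * r) => s with hP
  have hPc : P.card = B ^ (2 * r) := by simp [hP, hsc]
  have e1 : ∀ x : ZMod p, (∑ b ∈ s, (quadraticChar (ZMod p) (x + (b : ZMod p)) : ℝ)) ^ (2 * r) =
      ∑ b ∈ P, (quadraticChar (ZMod p) ((∏ i, (X + C (b i : ZMod p))).eval x) : ℝ) := by
    intro x
    have := Finset.prod_univ_sum (fun _ : Fin (2 * r) => s)
      (fun _ b => (quadraticChar (ZMod p) (x + (b : ZMod p)) : ℝ))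
    rw [Finset.prod_const, Finset.card_univ, Fintype.card_fin] at this
    rw [this]
    refine Finset.sum_congr rfl fun b _ => ?_
    rw [eval_prod, map_prod]
    push_cast
    simp
  rw [Finset.sum_congr rfl fun x _ => e1 x, Finset.sum_comm]
  let bad : (Fin (2 * r) → ℕ) → Prop := fun b =>
    ∀ v ∈ s, Even (Finset.univ.filter fun i => b i = v).card
  rw [← Finset.sum_filter_add_sum_filter_not P bad]
  have hp0 : (0 : ℝ) ≤ p := Nat.cast_nonneg _
  refine add_le_add ?_ ?_
  · have h1 : ∀ b ∈ P.filter bad, ∑ x : ZMod p, (quadraticChar (ZMod p)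
        ((∏ i, (X + C (b i : ZMod p))).eval x) : ℝ) ≤ p := by
      intro b _
      calc _ ≤ ∑ x : ZMod p, (1 : ℝ) :=
            Finset.sum_le_sum fun x _ => (abs_le.1 (abs_quadraticChar_le_one _)).2
        _ = p := by simp [ZMod.card]
    refine (Finset.sum_le_card_nsmul _ _ _ h1).trans ?_
    rw [nsmul_eq_mul]
    refine mul_le_mul_of_nonneg_right ?_ hp0
    have := card_tuples_even_fibers_le s hr
    rw [hsc] at this
    exact_mod_cast this
  · have h1 : ∀ b ∈ P.filter (fun b => ¬ bad b), ∑ x : ZMod p, (quadraticChar (ZMod p)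
        ((∏ i, (X + C (b i : ZMod p))).eval x) : ℝ) ≤ (32 * r + 16) * √p := by
      intro b hb
      rw [Finset.mem_filter, hP, Fintype.mem_piFinset] at hb
      obtain ⟨hbs, hb⟩ := hb
      simp only [bad] at hb
      push Not at hb
      obtain ⟨v, hv, hodd⟩ := hb
      have h2 := abs_sum_quadraticChar_le (p := p) (m := 2 * r)
        (f := ∏ i, (X + C (b i : ZMod p))) (a := -(v : ZMod p)) ?_ ?_ hp
      · refine (le_abs_self _).trans (h2.trans (le_of_eq ?_))
        push_cast
        ring
      · refine (natDegree_prod_le _ _).trans ?_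
        exact (Finset.sum_le_sum fun i _ => (natDegree_X_add_C _).le).trans (by simp)
      · rw [rootMultiplicity_prod_X_add_C]
        convert Nat.not_even_iff_odd.1 hodd using 3
        rename_i i _
        have h3 := Finset.mem_Icc.1 (hbs i)
        have h4 := Finset.mem_Icc.1 hv
        refine ⟨fun h => ?_, fun h => by rw [h]⟩
        rw [ZMod.natCast_eq_natCast_iff'] at h
        rwa [Nat.mod_eq_of_lt (by omega), Nat.mod_eq_of_lt (by omega)] at h
    refine (Finset.sum_le_card_nsmul _ _ _ h1).trans ?_
    rw [nsmul_eq_mul]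
    refine mul_le_mul_of_nonneg_right ?_ (by positivity)
    have := Finset.card_filter_le P (fun b => ¬ bad b)
    rw [hPc] at this
    exact_mod_cast this

/-- The partial sum `f 1 + ⋯ + f N`. -/
noncomputable def partialSum (f : ℕ → ℝ) (N : ℕ) : ℝ := ∑ n ∈ Finset.Icc 1 N, f n

theorem partialSum_add (f : ℕ → ℝ) (N h : ℕ) :
    partialSum f (N + h) = partialSum f N + ∑ n ∈ Finset.Icc 1 h, f (n + N) := by
  induction h with
  | zero => simp
  | succ h ih =>
    rw [← add_assoc, partialSum, Finset.sum_Icc_succ_top (by omega), ← partialSum, ih,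
      Finset.sum_Icc_succ_top (by omega), add_assoc, add_right_comm h 1 N, add_comm h N]

theorem abs_partialSum_le {f : ℕ → ℝ} (hf : ∀ n, |f n| ≤ 1) (N : ℕ) : |partialSum f N| ≤ N := by
  refine (Finset.abs_sum_le_sum_abs _ _).trans ((Finset.sum_le_sum fun n _ => hf n).trans ?_)
  simp

theorem abs_partialSum_add_sub_le {f : ℕ → ℝ} (hf : ∀ n, |f n| ≤ 1) (N h : ℕ) :
    |partialSum f (N + h) - partialSum f N| ≤ h := by
  rw [partialSum_add, add_sub_cancel_left]
  exact abs_partialSum_le (f := fun n => f (n + N)) (fun n => hf _) h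

theorem abs_partialSum_sub_sum_shift_le {f : ℕ → ℝ} (hf : ∀ n, |f n| ≤ 1) (N h : ℕ) :
    |partialSum f N - ∑ n ∈ Finset.Icc 1 N, f (n + h)| ≤ 2 * h := by
  have h1 := partialSum_add f h N
  have h2 := abs_partialSum_add_sub_le hf N h
  have h3 := abs_partialSum_le hf h
  rw [add_comm h N] at h1
  rw [show ∑ n ∈ Finset.Icc 1 N, f (n + h) = partialSum f (N + h) - partialSum f h by linarith]
  rw [abs_le] at *
  constructor <;> linarith

/-- The ratio `n / a` modulo `p` of a pair `(a, n)`. -/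
def ratioMod (p : ℕ) [Fact p.Prime] (w : ℕ × ℕ) : ZMod p := (w.2 : ZMod p) * (w.1 : ZMod p)⁻¹

theorem mul_eq_mul_of_ratioMod_eq {p : ℕ} [Fact p.Prime] {a n a' n' N : ℕ} (ha : 0 < a)
    (ha' : 0 < a') (haN : a * N < p) (haN' : a' * N < p) (hN : 0 < N) (hn : n ≤ N) (hn' : n' ≤ N)
    (h : ratioMod p (a, n) = ratioMod p (a', n')) : n * a' = n' * a := by
  have hap : (a : ZMod p) ≠ 0 := by
    rw [Ne, ZMod.natCast_eq_zero_iff]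
    exact Nat.not_dvd_of_pos_of_lt ha (by nlinarith)
  have hap' : (a' : ZMod p) ≠ 0 := by
    rw [Ne, ZMod.natCast_eq_zero_iff]
    exact Nat.not_dvd_of_pos_of_lt ha' (by nlinarith)
  have h1 : ((n * a' : ℕ) : ZMod p) = ((n' * a : ℕ) : ZMod p) := by
    simp only [ratioMod] at h
    push_cast
    field_simp at h
    rw [h, mul_comm]
  rw [ZMod.natCast_eq_natCast_iff', Nat.mod_eq_of_lt (by nlinarith),
    Nat.mod_eq_of_lt (by nlinarith)] at h1
  exact h1

theorem sum_card_ratioMod_fiber_le {p : ℕ} [Fact p.Prime] {A : Finset ℕ} {X N : ℕ} (hN : 0 < N)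
    (hA : ∀ a ∈ A, a.Prime) (hXA : ∀ a ∈ A, X ≤ a) (hAN : ∀ a ∈ A, a * N < p)
    (hcard : A.card ≤ X) :
    ∑ w ∈ A ×ˢ Finset.Icc 1 N,
      ((A ×ˢ Finset.Icc 1 N).filter fun w' => ratioMod p w' = ratioMod p w).card ≤
        2 * (A.card * N) := by
  classical
  set W := A ×ˢ Finset.Icc 1 N with hW
  have hfib : ∀ w ∈ W, (W.filter fun w' => ratioMod p w' = ratioMod p w).card ≤
      1 + (if w.1 ∣ w.2 then A.card else 0) := by
    rintro ⟨a, n⟩ hw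
    rw [hW, Finset.mem_product, Finset.mem_Icc] at hw
    have key : ∀ w' ∈ W.filter (fun w' => ratioMod p w' = ratioMod p (a, n)),
        w'.1 ∈ A ∧ w'.2 * a = n * w'.1 := by
      rintro ⟨a', n'⟩ h
      rw [Finset.mem_filter, hW, Finset.mem_product, Finset.mem_Icc] at h
      exact ⟨h.1.1, mul_eq_mul_of_ratioMod_eq (hA _ h.1.1).pos (hA _ hw.1).pos (hAN _ h.1.1)
        (hAN _ hw.1) hN h.1.2.2 hw.2.2 h.2⟩
    have ha0 : 0 < a := (hA _ hw.1).pos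
    have hinj : Set.InjOn Prod.fst
        (W.filter (fun w' => ratioMod p w' = ratioMod p (a, n)) : Set (ℕ × ℕ)) := by
      rintro ⟨a₁, n₁⟩ h₁ ⟨a₂, n₂⟩ h₂ h
      have k₁ := (key _ h₁).2
      have k₂ := (key _ h₂).2
      simp only at h k₁ k₂
      subst h
      rw [Nat.eq_of_mul_eq_mul_right ha0 (k₁.trans k₂.symm)]
    rw [← Finset.card_image_of_injOn hinj]
    by_cases hd : a ∣ n
    · simp only [hd, if_true]
      refine (Finset.card_le_card (t := A) ?_).trans (by omega)
      intro x hx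
      obtain ⟨w', hw', rfl⟩ := Finset.mem_image.1 hx
      exact (key _ hw').1
    · simp only [hd, if_false]
      refine (Finset.card_le_card (t := {a}) ?_).trans (by simp)
      intro x hx
      obtain ⟨w', hw', rfl⟩ := Finset.mem_image.1 hx
      obtain ⟨h1, h2⟩ := key _ hw'
      have h3 : a ∣ n * w'.1 := ⟨w'.2, by rw [← h2, mul_comm]⟩
      have h4 := ((hA _ hw.1).dvd_mul.1 h3).resolve_left hd
      rw [Finset.mem_singleton]
      exact ((Nat.prime_dvd_prime_iff_eq (hA _ hw.1) (hA _ h1)).1 h4).symm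
  refine (Finset.sum_le_sum hfib).trans ?_
  rw [Finset.sum_add_distrib, Finset.sum_product (f := fun w => if w.1 ∣ w.2 then A.card else 0)]
  have h1 : ∀ a ∈ A, ∑ n ∈ Finset.Icc 1 N, (if a ∣ n then A.card else 0) ≤ N := by
    intro a ha
    rw [← Finset.sum_filter, Finset.sum_const, smul_eq_mul]
    have h2 : ((Finset.Icc 1 N).filter (a ∣ ·)).card = N / a := by
      rw [← Nat.Ioc_filter_dvd_card_eq_div]
      rfl
    rw [h2]
    calc N / a * A.card ≤ N / a * a := Nat.mul_le_mul_left _ (hcard.trans (hXA a ha))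
      _ ≤ N := Nat.div_mul_le_self _ _
  refine (add_le_add le_rfl (Finset.sum_le_sum h1)).trans ?_
  simp [hW]
  omega

theorem sq_card_ratioMod_mem_le {p : ℕ} [Fact p.Prime] {A : Finset ℕ} {X N : ℕ} (hN : 0 < N)
    (hA : ∀ a ∈ A, a.Prime) (hXA : ∀ a ∈ A, X ≤ a) (hAN : ∀ a ∈ A, a * N < p)
    (hcard : A.card ≤ X) (E : Finset (ZMod p)) :
    ((A ×ˢ Finset.Icc 1 N).filter fun w => ratioMod p w ∈ E).card ^ 2 ≤
      E.card * (2 * (A.card * N)) := by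
  classical
  set W := A ×ˢ Finset.Icc 1 N with hW
  have h1 : (W.filter fun w => ratioMod p w ∈ E).card =
      ∑ x ∈ E, (W.filter fun w => ratioMod p w = x).card := by
    rw [Finset.card_eq_sum_card_fiberwise (f := ratioMod p) (t := E)
      (fun w hw => by simpa using (Finset.mem_filter.1 hw).2)]
    refine Finset.sum_congr rfl fun x hx => congrArg _ ?_
    rw [Finset.filter_filter]
    refine Finset.filter_congr fun w _ => ⟨fun h => h.2, fun h => ⟨h ▸ hx, h⟩⟩
  rw [h1]
  refine sq_sum_le_card_mul_sum_sq.trans (Nat.mul_le_mul_left _ ?_)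
  refine le_trans ?_ (sum_card_ratioMod_fiber_le (p := p) hN hA hXA hAN hcard)
  have h2 : ∀ x ∈ E, (W.filter fun w => ratioMod p w = x).card ^ 2 =
      ∑ w ∈ W with ratioMod p w = x, (W.filter fun w' => ratioMod p w' = ratioMod p w).card := by
    intro x _
    rw [pow_two, ← smul_eq_mul, ← Finset.sum_const]
    refine Finset.sum_congr rfl fun w hw => ?_
    rw [(Finset.mem_filter.1 hw).2]
  rw [Finset.sum_congr rfl h2]
  calc _ ≤ ∑ x : ZMod p, ∑ w ∈ W with ratioMod p w = x,
        (W.filter fun w' => ratioMod p w' = ratioMod p w).card :=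
        Finset.sum_le_sum_of_subset (Finset.subset_univ _)
    _ = _ := Finset.sum_fiberwise _ _ _

theorem quadraticChar_add_mul {p : ℕ} [Fact p.Prime] {a n b : ℕ} (ha : (a : ZMod p) ≠ 0) :
    (quadraticChar (ZMod p) ((n + a * b : ℕ) : ZMod p) : ℝ) = quadraticChar (ZMod p) (a : ZMod p) *
      quadraticChar (ZMod p) (ratioMod p (a, n) + (b : ZMod p)) := by
  have : ((n + a * b : ℕ) : ZMod p) = (a : ZMod p) * (ratioMod p (a, n) + (b : ZMod p)) := by
    simp only [ratioMod]
    push_cast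
    field_simp
  rw [this, map_mul]
  push_cast
  rfl

/-- The core of Burgess' argument, with free parameters. -/
theorem burgess_abs_partialSum_le {p : ℕ} [Fact p.Prime] {A : Finset ℕ} {X N B : ℕ} (hN : 0 < N)
    (hB : 0 < B) (hA0 : A.Nonempty) (hA : ∀ a ∈ A, a.Prime) (hXA : ∀ a ∈ A, X ≤ a)
    (hAX : ∀ a ∈ A, a ≤ 4 * X) (hAN : ∀ a ∈ A, a * N < p) (hcard : A.card ≤ X) {τ : ℝ}
    (hτ : 0 < τ) (hXB : 8 * (X : ℝ) * B ≤ τ * N) (E : Finset (ZMod p))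
    (hE : ∀ x ∉ E, |∑ b ∈ Finset.Icc 1 B,
      (quadraticChar (ZMod p) (x + (b : ZMod p)) : ℝ)| ≤ τ * B)
    (hEcard : 2 * (E.card : ℝ) ≤ τ ^ 2 * (A.card * N)) :
    |partialSum (fun n => (quadraticChar (ZMod p) (n : ZMod p) : ℝ)) N| ≤ 3 * τ * N := by
  classical
  set f : ℕ → ℝ := fun n => (quadraticChar (ZMod p) (n : ZMod p) : ℝ) with hf
  have hf1 : ∀ n, |f n| ≤ 1 := fun n => abs_quadraticChar_le_one _
  set W := A ×ˢ Finset.Icc 1 N with hW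
  set T : ZMod p → ℝ := fun x => ∑ b ∈ Finset.Icc 1 B,
      (quadraticChar (ZMod p) (x + (b : ZMod p)) : ℝ) with hT
  have hTB : ∀ x, |T x| ≤ B := fun x =>
    abs_partialSum_le (f := fun b => (quadraticChar (ZMod p) (x + (b : ZMod p)) : ℝ))
      (fun n => abs_quadraticChar_le_one _) B
  set M := (W.filter fun w => ratioMod p w ∈ E).card with hM
  have hA0' : (0 : ℝ) < A.card := by exact_mod_cast hA0.card_pos
  have hN' : (0 : ℝ) < N := by exact_mod_cast hN
  have hB' : (0 : ℝ) < B := by exact_mod_cast hB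
  have hM1 : (M : ℝ) ≤ τ * (A.card * N) := by
    have h1 : (M : ℝ) ^ 2 ≤ E.card * (2 * (A.card * N)) := by
      exact_mod_cast sq_card_ratioMod_mem_le (p := p) hN hA hXA hAN hcard E
    refine (sq_le_sq₀ (by positivity) (by positivity)).1 ?_
    nlinarith [mul_pos hA0' hN']
  have h1 : |∑ a ∈ A, ∑ b ∈ Finset.Icc 1 B, (partialSum f N -
      ∑ n ∈ Finset.Icc 1 N, f (n + a * b))| ≤ A.card * (B * (τ * N)) := by
    refine (Finset.abs_sum_le_sum_abs _ _).trans ?_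
    rw [← nsmul_eq_mul]
    refine Finset.sum_le_card_nsmul _ _ _ fun a ha => ?_
    refine (Finset.abs_sum_le_sum_abs _ _).trans ?_
    have : (B : ℝ) * (τ * N) = (Finset.Icc 1 B).card • (τ * N) := by simp
    rw [this]
    refine Finset.sum_le_card_nsmul _ _ _ fun b hb => ?_
    refine (abs_partialSum_sub_sum_shift_le hf1 N (a * b)).trans (le_trans ?_ hXB)
    have h2 : a * b ≤ 4 * X * B := Nat.mul_le_mul (hAX a ha) (Finset.mem_Icc.1 hb).2
    have h3 : ((a * b : ℕ) : ℝ) ≤ 4 * X * B := by exact_mod_cast h2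
    linarith
  have h2 : |∑ a ∈ A, ∑ b ∈ Finset.Icc 1 B, ∑ n ∈ Finset.Icc 1 N, f (n + a * b)| ≤
      A.card * N * (τ * B) + M * B := by
    have e : ∑ a ∈ A, ∑ b ∈ Finset.Icc 1 B, ∑ n ∈ Finset.Icc 1 N, f (n + a * b) =
        ∑ w ∈ W, ∑ b ∈ Finset.Icc 1 B, f (w.2 + w.1 * b) := by
      rw [hW, Finset.sum_product]
      exact Finset.sum_congr rfl fun a _ => Finset.sum_comm
    rw [e]
    refine (Finset.abs_sum_le_sum_abs _ _).trans ?_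
    have h3 : ∀ w ∈ W, |∑ b ∈ Finset.Icc 1 B, f (w.2 + w.1 * b)| ≤
        τ * B + if ratioMod p w ∈ E then (B : ℝ) else 0 := by
      rintro ⟨a, n⟩ hw
      rw [hW, Finset.mem_product] at hw
      have hap : (a : ZMod p) ≠ 0 := by
        rw [Ne, ZMod.natCast_eq_zero_iff]
        exact Nat.not_dvd_of_pos_of_lt (hA _ hw.1).pos (by nlinarith [hAN _ hw.1])
      have h4 : ∑ b ∈ Finset.Icc 1 B, f (n + a * b) =
          (quadraticChar (ZMod p) (a : ZMod p) : ℝ) * T (ratioMod p (a, n)) := by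
        rw [hT, Finset.mul_sum]
        exact Finset.sum_congr rfl fun b _ => quadraticChar_add_mul hap
      simp only [h4, abs_mul]
      have h5 : |(quadraticChar (ZMod p) (a : ZMod p) : ℝ)| * |T (ratioMod p (a, n))| ≤
          |T (ratioMod p (a, n))| :=
        mul_le_of_le_one_left (abs_nonneg _) (abs_quadraticChar_le_one _)
      refine h5.trans ?_
      split_ifs with hmem
      · have := hTB (ratioMod p (a, n))
        nlinarith [mul_pos hτ hB']
      · rw [add_zero]
        exact hE _ hmem
    refine (Finset.sum_le_sum h3).trans (le_of_eq ?_)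
    rw [Finset.sum_add_distrib, ← Finset.sum_filter]
    simp [hW, hM]
  have h3 : ∑ a ∈ A, ∑ b ∈ Finset.Icc 1 B, (partialSum f N -
      ∑ n ∈ Finset.Icc 1 N, f (n + a * b)) = A.card * (B * partialSum f N) -
      ∑ a ∈ A, ∑ b ∈ Finset.Icc 1 B, ∑ n ∈ Finset.Icc 1 N, f (n + a * b) := by
    simp [Finset.sum_sub_distrib]
  rw [h3] at h1
  have h4 : |A.card * (B * partialSum f N)| ≤ A.card * (B * (3 * τ * N)) := by
    have h5 := abs_le.1 h1
    have h6 := abs_le.1 h2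
    have h7 : (M : ℝ) * B ≤ τ * (A.card * N) * B := mul_le_mul_of_nonneg_right hM1 hB'.le
    rw [abs_le]
    constructor <;> nlinarith
  rw [abs_mul, abs_mul, abs_of_pos hA0', abs_of_pos hB'] at h4
  exact le_of_mul_le_mul_left (le_of_mul_le_mul_left h4 hA0') hB'

theorem card_large_sum_quadraticChar_le {p : ℕ} [Fact p.Prime] {r B : ℕ} (hr : 0 < r)
    (hB0 : 0 < B) (hB : B < p) (hp : 16 * (2 * r + 2) ^ 2 ≤ p) (hBr : √(p : ℝ) ≤ (B : ℝ) ^ r) {τ : ℝ}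
    (hτ : 0 < τ) :
    ((Finset.univ.filter fun x : ZMod p => τ * B < |∑ b ∈ Finset.Icc 1 B,
      (quadraticChar (ZMod p) (x + (b : ZMod p)) : ℝ)|).card : ℝ) * τ ^ (2 * r) ≤
      (r ^ (2 * r) + 32 * r + 16) * √p := by
  set T : ZMod p → ℝ := fun x => ∑ b ∈ Finset.Icc 1 B,
      (quadraticChar (ZMod p) (x + (b : ZMod p)) : ℝ) with hT
  set E := Finset.univ.filter fun x : ZMod p => τ * B < |T x| with hE
  have hB' : (0 : ℝ) < B := by exact_mod_cast hB0
  have h1 : (E.card : ℝ) * (τ * B) ^ (2 * r) ≤ ∑ x : ZMod p, T x ^ (2 * r) := by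
    rw [← nsmul_eq_mul]
    refine (Finset.card_nsmul_le_sum E (fun x => T x ^ (2 * r)) _ fun x hx => ?_).trans
      (Finset.sum_le_sum_of_subset_of_nonneg (Finset.subset_univ _) fun x _ _ => ?_)
    · rw [← (even_two_mul r).pow_abs (T x)]
      exact pow_le_pow_left₀ (by positivity) (Finset.mem_filter.1 hx).2.le _
    · exact (even_two_mul r).pow_nonneg _
  have h2 := h1.trans (sum_pow_sum_quadraticChar_le hr hB hp)
  have hs : √(p : ℝ) * √(p : ℝ) = p := Real.mul_self_sqrt (by positivity)
  have h3 : (r : ℝ) ^ (2 * r) * B ^ r * p ≤ r ^ (2 * r) * √p * (B : ℝ) ^ (2 * r) := by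
    have : (B : ℝ) ^ r * √p * √p ≤ B ^ r * √p * B ^ r :=
      mul_le_mul_of_nonneg_left hBr (by positivity)
    calc (r : ℝ) ^ (2 * r) * B ^ r * p = r ^ (2 * r) * (B ^ r * √p * √p) := by
          rw [mul_assoc ((B : ℝ) ^ r), hs]; ring
      _ ≤ r ^ (2 * r) * (B ^ r * √p * B ^ r) := mul_le_mul_of_nonneg_left this (by positivity)
      _ = _ := by ring
  have hBp : (0 : ℝ) < (B : ℝ) ^ (2 * r) := by positivity
  refine le_of_mul_le_mul_right ?_ hBp
  rw [mul_pow] at h2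
  nlinarith

theorem ten_mul_add_two_le_two_pow {k : ℕ} (hk : 7 ≤ k) : 10 * (k + 2) ≤ 2 ^ k := by
  induction k, hk using Nat.le_induction with
  | base => norm_num
  | succ k hk ih => rw [pow_succ]; omega

/-- A Chebyshev-type lower bound for the number of primes in `[4 ^ k, 4 ^ (k + 1))`. -/
theorem exists_primes_card_eq {k : ℕ} (hk : 7 ≤ k) : ∃ A : Finset ℕ, A.card = 4 ^ k / (4 * k) ∧
    ∀ a ∈ A, a.Prime ∧ 4 ^ k ≤ a ∧ a < 4 ^ (k + 1) := by
  set A := (Finset.Ioc (4 ^ k) (4 ^ (k + 1))).filter Nat.Prime with hA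
  suffices h : 4 ^ k / (4 * k) ≤ A.card by
    obtain ⟨A', hA', hc⟩ := Finset.exists_subset_card_eq h
    refine ⟨A', hc, fun a ha => ?_⟩
    have := hA' ha
    rw [hA, Finset.mem_filter, Finset.mem_Ioc] at this
    refine ⟨this.2, this.1.1.le, lt_of_le_of_ne this.1.2 ?_⟩
    rintro rfl
    exact Nat.Prime.not_prime_pow (by omega) this.2
  have hlog4 : Real.log 4 = 2 * Real.log 2 := by
    rw [show (4 : ℝ) = 2 ^ 2 by norm_num, Real.log_pow]; norm_num
  have hl2 : 0 < Real.log 2 := Real.log_pos (by norm_num)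
  have h1 := Chebyshev.theta_ge (4 ^ (k + 1))
  have h2 := Chebyshev.theta_le_log4_mul_x (x := ((4 ^ k : ℕ) : ℝ)) (by positivity)
  have h3 : Chebyshev.theta ((4 ^ (k + 1) : ℕ) : ℝ) - Chebyshev.theta ((4 ^ k : ℕ) : ℝ) ≤
      A.card * ((k + 1) * (2 * Real.log 2)) := by
    have e : Chebyshev.theta ((4 ^ (k + 1) : ℕ) : ℝ) = Chebyshev.theta ((4 ^ k : ℕ) : ℝ) +
        ∑ a ∈ A, Real.log a := by
      simp only [Chebyshev.theta, Nat.floor_natCast, hA]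
      rw [← Finset.Ioc_union_Ioc_eq_Ioc (Nat.zero_le (4 ^ k))
        (Nat.pow_le_pow_right (by norm_num) (Nat.le_succ k)), Finset.filter_union,
        Finset.sum_union]
      refine Finset.disjoint_filter_filter ?_
      rw [Finset.disjoint_left]
      intro x hx hx'
      rw [Finset.mem_Ioc] at hx hx'
      omega
    rw [e, add_sub_cancel_left, ← nsmul_eq_mul]
    refine Finset.sum_le_card_nsmul _ _ _ fun a ha => ?_
    rw [hA, Finset.mem_filter, Finset.mem_Ioc] at ha
    rw [← hlog4]
    have : ((k : ℝ) + 1) * Real.log 4 = Real.log ((4 ^ (k + 1) : ℕ) : ℝ) := by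
      push_cast
      rw [Real.log_pow]; push_cast; ring
    rw [this]
    exact Real.log_le_log (by exact_mod_cast ha.2.pos) (by exact_mod_cast ha.1.2)
  have h4 : Real.log (((4 ^ (k + 1) : ℕ) : ℝ) + 1) ≤ (k + 2) * (2 * Real.log 2) := by
    rw [← hlog4]
    have : ((k : ℝ) + 2) * Real.log 4 = Real.log (4 ^ (k + 2)) := by
      rw [Real.log_pow]; push_cast; ring
    rw [this]
    refine Real.log_le_log (by positivity) ?_
    push_cast
    have : (1 : ℝ) ≤ 4 ^ k := one_le_pow₀ (by norm_num)
    rw [pow_succ, pow_add]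
    linarith
  have h5 : √((4 ^ (k + 1) : ℕ) : ℝ) = 2 * 2 ^ k := by
    rw [Real.sqrt_eq_iff_mul_self_eq (by positivity) (by positivity)]
    push_cast
    rw [pow_succ, show (4 : ℝ) = 2 * 2 by norm_num, mul_pow]
    ring
  have h6 : Real.log ((4 ^ (k + 1) : ℕ) : ℝ) = (k + 1) * (2 * Real.log 2) := by
    rw [← hlog4]
    push_cast
    rw [Real.log_pow]; push_cast; ring
  rw [h5, h6] at h1
  rw [hlog4] at h2
  have h7 : (10 : ℝ) * (k + 2) ≤ 2 ^ k := by exact_mod_cast ten_mul_add_two_le_two_pow hk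
  have h8 : (4 : ℝ) ^ k = 2 ^ k * 2 ^ k := by rw [← mul_pow]; norm_num
  push_cast at h1 h2 h3 h4
  have h9 : (4 : ℝ) ^ k * Real.log 2 ≤ A.card * ((k + 1) * 2) * Real.log 2 := by
    have h10 : (4 : ℝ) ^ k ≥ (k + 2) * 2 + 8 * 2 ^ k * (k + 1) := by
      rw [h8]
      have : (1 : ℝ) ≤ 2 ^ k := one_le_pow₀ (by norm_num)
      nlinarith
    have h11 := mul_le_mul_of_nonneg_right h10 hl2.le
    rw [pow_succ] at h1 h3 h4
    nlinarith
  have h10 : (4 : ℝ) ^ k ≤ A.card * ((k + 1) * 2) := le_of_mul_le_mul_right h9 hl2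
  have h11 : 4 ^ k ≤ A.card * ((k + 1) * 2) := by exact_mod_cast h10
  refine Nat.div_le_of_le_mul (h11.trans ?_)
  rw [mul_comm]
  exact Nat.mul_le_mul_right _ (by omega)

theorem le_mul_card_of_eq_div {k c : ℕ} (hk : 7 ≤ k) (hc : c = 4 ^ k / (4 * k)) :
    4 ^ k ≤ 8 * k * c := by
  have h1 : 4 ^ k < 4 * k * (c + 1) := by
    rw [hc]; exact Nat.lt_mul_div_succ _ (by omega)
  have h2 := ten_mul_add_two_le_two_pow hk
  have h3 : 2 ^ k ≤ 4 ^ k := Nat.pow_le_pow_left (by norm_num) k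
  nlinarith

set_option maxHeartbeats 1000000 in
open Filter in
/-- Burgess' bound for initial intervals, in qualitative form. -/
theorem eventually_abs_partialSum_quadraticChar_le {δ τ : ℝ} (hδ : 0 < δ) (hτ : 0 < τ)
    (hτ1 : τ ≤ 1) : ∀ᶠ p : ℕ in atTop, ∀ _ : Fact p.Prime, ∀ N : ℕ,
      (p : ℝ) ^ (1 / 4 + δ) ≤ N → (N : ℝ) ≤ (p : ℝ) ^ (3 / 8 : ℝ) →
      |partialSum (fun n => (quadraticChar (ZMod p) (n : ZMod p) : ℝ)) N| ≤ 3 * τ * N := by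
  obtain ⟨r, hr⟩ := exists_nat_gt (1 / (2 * δ))
  have hr0' : (0 : ℝ) < r := lt_trans (by positivity) hr
  have hr0 : 0 < r := by exact_mod_cast hr0'
  have hrδ : 1 / (2 * r : ℝ) ≤ δ := by
    rw [div_lt_iff₀ (by positivity)] at hr
    rw [div_le_iff₀ (by positivity)]
    linarith
  set C : ℝ := r ^ (2 * r) + 32 * r + 16 with hC
  have hC0 : 0 < C := by positivity
  set D : ℝ := 1024 * C / τ ^ (2 * r + 3) with hD
  have hD0 : 0 < D := by positivity
  have hcast : Tendsto (fun p : ℕ => (p : ℝ)) atTop atTop := tendsto_natCast_atTop_atTop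
  have ev1 : ∀ᶠ p : ℕ in atTop, 16 * (2 * r + 2) ^ 2 ≤ p := eventually_ge_atTop _
  have ev2 : ∀ᶠ p : ℕ in atTop, 16 / τ * 4 ^ 8 ≤ (p : ℝ) ^ (1 / 4 : ℝ) :=
    ((tendsto_rpow_atTop (by norm_num)).comp hcast).eventually_ge_atTop _
  have ev3 : ∀ᶠ p : ℕ in atTop, Real.log p ≤ 1 / D * (p : ℝ) ^ δ := by
    have h := ((isLittleO_log_rpow_atTop hδ).comp_tendsto hcast).bound
      (show 0 < 1 / D by positivity)
    filter_upwards [h, eventually_ge_atTop 1] with p hp hp1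
    have hp1' : (1 : ℝ) ≤ p := by exact_mod_cast hp1
    simp only [Function.comp_apply, Real.norm_eq_abs] at hp
    rwa [abs_of_nonneg (Real.log_nonneg hp1'), abs_of_nonneg (by positivity)] at hp
  filter_upwards [ev1, ev2, ev3] with p hp1 hp2 hp3 hprime N hN1 hN2
  obtain ⟨P, hP⟩ : ∃ P : ℝ, P = p := ⟨_, rfl⟩
  rw [← hP] at hp2 hp3 hN1 hN2
  have hP64 : (64 : ℝ) ≤ P := by
    have : 64 ≤ p := by nlinarith
    rw [hP]; exact_mod_cast this
  have hP1 : (1 : ℝ) ≤ P := by linarith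
  have hP0 : (0 : ℝ) < P := by linarith
  set q : ℝ := P ^ (1 / (2 * r) : ℝ) with hq
  have hq1 : 1 ≤ q := Real.one_le_rpow hP1 (by positivity)
  have hqδ : q ≤ P ^ δ := Real.rpow_le_rpow_of_exponent_le hP1 hrδ
  have hqr : q ^ r = √P := by
    rw [hq, ← Real.rpow_natCast, ← Real.rpow_mul hP0.le, Real.sqrt_eq_rpow]
    congr 1
    field_simp
  have hqs : q ≤ √P := by
    rw [← hqr]
    exact le_self_pow₀ hq1 hr0.ne'
  have hss : √P * √P = P := Real.mul_self_sqrt hP0.le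
  have hs8 : 8 ≤ √P := Real.le_sqrt_of_sq_le (by linarith)
  set B := ⌈q⌉₊ with hB
  have hqB : q ≤ B := Nat.le_ceil _
  have hBq : (B : ℝ) ≤ 2 * q := by
    have := (Nat.ceil_lt_add_one (by linarith : 0 ≤ q)).le
    linarith
  have hB0 : 0 < B := Nat.ceil_pos.2 (by linarith)
  have hB0' : (0 : ℝ) < B := by exact_mod_cast hB0
  have hBp : B < p := by
    have : (B : ℝ) < P := by nlinarith
    rw [hP] at this; exact_mod_cast this
  have hBr : √P ≤ (B : ℝ) ^ r := by
    rw [← hqr]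
    exact pow_le_pow_left₀ (by linarith) hqB r
  set R : ℝ := P ^ (1 / 4 : ℝ) with hR
  have hR0 : 0 < R := by positivity
  have hRR : R * R = √P := by
    rw [hR, ← Real.rpow_add hP0, Real.sqrt_eq_rpow]; norm_num
  have hN1' : R * P ^ δ ≤ N := by rwa [hR, ← Real.rpow_add hP0]
  have hδ1 : 1 ≤ P ^ δ := Real.one_le_rpow hP1 hδ.le
  have hN0' : (0 : ℝ) < N := lt_of_lt_of_le (by positivity) hN1'
  have hN0 : 0 < N := by exact_mod_cast hN0'
  have hNN : (N : ℝ) * N < P := by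
    calc (N : ℝ) * N ≤ P ^ (3 / 8 : ℝ) * P ^ (3 / 8 : ℝ) := by gcongr
      _ = P ^ (3 / 4 : ℝ) := by rw [← Real.rpow_add hP0]; norm_num
      _ < P ^ (1 : ℝ) := Real.rpow_lt_rpow_of_exponent_lt (by linarith) (by norm_num)
      _ = P := Real.rpow_one _
  have hNP : (N : ℝ) ≤ P := by
    refine hN2.trans ?_
    calc P ^ (3 / 8 : ℝ) ≤ P ^ (1 : ℝ) := Real.rpow_le_rpow_of_exponent_le hP1 (by norm_num)
      _ = P := Real.rpow_one _
  set Y : ℝ := τ * N / (8 * B) with hY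
  have hYR : τ / 16 * R ≤ Y := by
    rw [hY, le_div_iff₀ (by positivity)]
    have : R * q ≤ N := (mul_le_mul_of_nonneg_left hqδ hR0.le).trans hN1'
    calc τ / 16 * R * (8 * B) ≤ τ / 16 * R * (8 * (2 * q)) := by gcongr
      _ = τ * (R * q) := by ring
      _ ≤ τ * N := by gcongr
  have hY8 : (4 : ℝ) ^ 8 ≤ Y := by
    refine le_trans ?_ hYR
    have := mul_le_mul_of_nonneg_left hp2 (by positivity : 0 ≤ τ / 16)
    calc (4 : ℝ) ^ 8 = τ / 16 * (16 / τ * 4 ^ 8) := by field_simp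
      _ ≤ _ := this
  have hYN : Y ≤ N / 8 := by
    rw [hY, div_le_iff₀ (by positivity)]
    have : (1 : ℝ) ≤ B := by exact_mod_cast hB0
    nlinarith
  have hfl : ⌊Y⌋₊ ≠ 0 := by
    rw [← Nat.pos_iff_ne_zero, Nat.floor_pos]; linarith
  set k := Nat.log 4 ⌊Y⌋₊ with hk
  have hkY : (4 : ℝ) ^ k ≤ Y := by
    have := Nat.pow_log_le_self 4 hfl
    calc (4 : ℝ) ^ k ≤ (⌊Y⌋₊ : ℝ) := by exact_mod_cast this
      _ ≤ Y := Nat.floor_le (by linarith)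
  have hYk : Y < (4 : ℝ) ^ (k + 1) := by
    have := Nat.lt_pow_succ_log_self (b := 4) (by norm_num) ⌊Y⌋₊
    rw [Nat.floor_lt (by linarith)] at this
    exact_mod_cast this
  have hk7 : 7 ≤ k := by
    have : (4 : ℝ) ^ 8 < 4 ^ (k + 1) := lt_of_le_of_lt hY8 hYk
    have := (pow_lt_pow_iff_right₀ (by norm_num : (1 : ℝ) < 4)).1 this
    omega
  have hk0 : (0 : ℝ) < k := by exact_mod_cast (by omega : 0 < k)
  have hklog : (k : ℝ) ≤ Real.log P := by
    have h1 : (4 : ℝ) ^ k ≤ P := by linarith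
    have h2 := Real.log_le_log (by positivity) h1
    rw [Real.log_pow] at h2
    have h3 : 1 ≤ Real.log 4 := by
      rw [Real.le_log_iff_exp_le (by norm_num)]
      linarith [Real.exp_one_lt_d9]
    exact (le_mul_of_one_le_right hk0.le h3).trans h2
  obtain ⟨A, hAc, hA⟩ := exists_primes_card_eq hk7
  have hA8 : (4 : ℝ) ^ k ≤ 8 * k * A.card := by exact_mod_cast le_mul_card_of_eq_div hk7 hAc
  have hA0 : A.Nonempty := by
    rw [← Finset.card_pos]
    by_contra h
    have : A.card = 0 := by omega
    rw [this] at hA8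
    have : (0 : ℝ) < 4 ^ k := by positivity
    simp at hA8
    linarith
  have hlow : √P * P ^ δ * τ ≤ 512 * k * (A.card * N) := by
    have h1 : τ * N ≤ 8 * k * A.card * 4 * (8 * B) := by
      rw [pow_succ] at hYk
      have h2 : Y ≤ 8 * k * A.card * 4 := by linarith
      rwa [hY, div_le_iff₀ (by positivity)] at h2
    have h2 : τ * N ≤ 512 * k * A.card * q := by
      refine h1.trans ?_
      calc 8 * (k : ℝ) * A.card * 4 * (8 * B) ≤ 8 * k * A.card * 4 * (8 * (2 * q)) := by gcongr
        _ = _ := by ring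
    have h3 : (R * P ^ δ) * (R * q) ≤ N * N := by
      refine mul_le_mul hN1' ?_ (by positivity) hN0'.le
      exact (mul_le_mul_of_nonneg_left hqδ hR0.le).trans hN1'
    have hq0 : 0 < q := by linarith
    refine le_of_mul_le_mul_right ?_ hq0
    calc √P * P ^ δ * τ * q = τ * ((R * P ^ δ) * (R * q)) := by rw [← hRR]; ring
      _ ≤ τ * (N * N) := by gcongr
      _ = τ * N * N := by ring
      _ ≤ 512 * k * A.card * q * N := by gcongr
      _ = _ := by ring
  have hDk : D * k ≤ P ^ δ := by
    have h1 := hklog.trans hp3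
    rw [div_mul_eq_mul_div, one_mul, le_div_iff₀ hD0] at h1
    linarith
  set E := Finset.univ.filter fun x : ZMod p => τ * B < |∑ b ∈ Finset.Icc 1 B,
      (quadraticChar (ZMod p) (x + (b : ZMod p)) : ℝ)| with hE
  have hEc : (E.card : ℝ) * τ ^ (2 * r) ≤ C * √P :=
    hP ▸ card_large_sum_quadraticChar_le hr0 hB0 hBp hp1 (hP ▸ hBr) hτ
  have hAN4 : ∀ a ∈ A, (a : ℝ) ≤ 4 * 4 ^ k := by
    intro a ha
    have := (hA a ha).2.2.le
    rw [pow_succ, mul_comm] at this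
    exact_mod_cast this
  refine burgess_abs_partialSum_le (A := A) (X := 4 ^ k) (B := B) hN0 hB0 hA0
    (fun a ha => (hA a ha).1) (fun a ha => (hA a ha).2.1) (fun a ha => ?_) (fun a ha => ?_)
    ?_ hτ ?_ E (fun x hx => ?_) ?_
  · exact_mod_cast hAN4 a ha
  · have h1 : (a : ℝ) * N < P := by
      refine lt_of_le_of_lt ?_ hNN
      have := hAN4 a ha
      exact mul_le_mul_of_nonneg_right (by linarith) hN0'.le
    rw [hP] at h1; exact_mod_cast h1
  · rw [hAc]; exact Nat.div_le_self _ _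
  · have := hkY
    rw [hY, le_div_iff₀ (by positivity)] at this
    push_cast
    linarith
  · simpa [hE] using hx
  · have h1 : D * √P * τ ≤ 512 * (A.card * N) := by
      refine le_of_mul_le_mul_right ?_ hk0
      calc D * √P * τ * k = √P * (D * k) * τ := by ring
        _ ≤ √P * P ^ δ * τ := by gcongr
        _ ≤ 512 * k * (A.card * N) := hlow
        _ = _ := by ring
    have h2 : D * τ * τ ^ (2 * r + 2) = 1024 * C := by
      rw [hD]; field_simp; ring
    have h3 : 0 < τ ^ (2 * r) := by positivity
    refine le_of_mul_le_mul_right ?_ h3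
    have h4 : 1024 * C * √P ≤ 512 * (A.card * N) * τ ^ (2 * r + 2) := by
      rw [← h2]
      calc D * τ * τ ^ (2 * r + 2) * √P = D * √P * τ * τ ^ (2 * r + 2) := by ring
        _ ≤ _ := by gcongr
    rw [pow_add] at h4
    linarith

theorem sum_multiples_eq_partialSum {f : ℕ → ℝ} (hmul : ∀ m n, f (m * n) = f m * f n) {q : ℕ}
    (hq : 0 < q) (x : ℕ) :
    ∑ n ∈ (Finset.Icc 1 x).filter (q ∣ ·), f n = f q * partialSum f (x / q) := by
  rw [partialSum, Finset.mul_sum]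
  symm
  refine Finset.sum_bij (fun n _ => q * n) ?_ ?_ ?_ ?_
  · intro n hn
    rw [Finset.mem_Icc] at hn
    rw [Finset.mem_filter, Finset.mem_Icc]
    refine ⟨⟨Nat.mul_pos hq hn.1, ?_⟩, dvd_mul_right _ _⟩
    exact (Nat.mul_le_mul_left q hn.2).trans (Nat.mul_div_le x q)
  · intro a _ b _ h
    exact Nat.eq_of_mul_eq_mul_left hq h
  · intro n hn
    rw [Finset.mem_filter, Finset.mem_Icc] at hn
    obtain ⟨⟨h1, h2⟩, c, rfl⟩ := hn
    refine ⟨c, ?_, rfl⟩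
    rw [Finset.mem_Icc, Nat.le_div_iff_mul_le hq, mul_comm]
    exact ⟨Nat.pos_of_ne_zero fun h => by simp [h] at h1, h2⟩
  · intro n _
    exact (hmul q n).symm

theorem sum_sq_card_dvd_sub_le {P : Finset ℕ} {x : ℕ} (hP : ∀ q ∈ P, q.Prime)
    (hPx : ∀ q ∈ P, q ≤ x) :
    ∑ n ∈ Finset.Icc 1 x, (((P.filter (· ∣ n)).card : ℝ) - ∑ q ∈ P, (1 / q : ℝ)) ^ 2 ≤
      3 * x * ∑ q ∈ P, (1 / q : ℝ) := by
  set L : ℝ := ∑ q ∈ P, (1 / q : ℝ) with hL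
  have hL0 : 0 ≤ L := Finset.sum_nonneg fun q _ => by positivity
  have hcard : (P.card : ℝ) ≤ x := by
    have : P ⊆ Finset.Icc 1 x := fun q hq =>
      Finset.mem_Icc.2 ⟨(hP q hq).one_lt.le, hPx q hq⟩
    have := Finset.card_le_card this
    rw [Nat.card_Icc] at this
    exact_mod_cast this
  have hmult : ∀ q : ℕ, ∑ n ∈ Finset.Icc 1 x, (if q ∣ n then (1 : ℝ) else 0) = (x / q : ℕ) := by
    intro q
    rw [Finset.sum_boole, ← Nat.Ioc_filter_dvd_card_eq_div]
    rfl
  have hω : ∀ n, ((P.filter (· ∣ n)).card : ℝ) = ∑ q ∈ P, if q ∣ n then (1 : ℝ) else 0 := by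
    intro n; rw [Finset.sum_boole]
  have h1 : x * L - x ≤ ∑ n ∈ Finset.Icc 1 x, ((P.filter (· ∣ n)).card : ℝ) := by
    simp_rw [hω]
    rw [Finset.sum_comm]
    simp_rw [hmult]
    have : ∑ q ∈ P, ((x : ℝ) * (1 / q) - 1) ≤ ∑ q ∈ P, ((x / q : ℕ) : ℝ) := by
      refine Finset.sum_le_sum fun q _ => ?_
      have := (Nat.lt_floor_add_one ((x : ℝ) / q)).le
      rw [Nat.floor_div_eq_div] at this
      rw [mul_one_div]; linarith
    rw [Finset.sum_sub_distrib, ← Finset.mul_sum, Finset.sum_const, nsmul_eq_mul, mul_one] at this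
    linarith
  have h2 : ∑ n ∈ Finset.Icc 1 x, ((P.filter (· ∣ n)).card : ℝ) ^ 2 ≤ x * L ^ 2 + x * L := by
    have e : ∀ n, ((P.filter (· ∣ n)).card : ℝ) ^ 2 =
        ∑ q ∈ P, ∑ q' ∈ P, if q ∣ n ∧ q' ∣ n then (1 : ℝ) else 0 := by
      intro n
      rw [hω, sq, Finset.sum_mul_sum]
      refine Finset.sum_congr rfl fun q _ => Finset.sum_congr rfl fun q' _ => ?_
      rw [ite_and]
      split_ifs <;> simp
    simp_rw [e]
    rw [Finset.sum_comm]
    simp_rw [Finset.sum_comm (s := Finset.Icc 1 x)]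
    have hb : ∀ q ∈ P, ∀ q' ∈ P,
        ∑ n ∈ Finset.Icc 1 x, (if q ∣ n ∧ q' ∣ n then (1 : ℝ) else 0) ≤
          x * ((1 / q) * (1 / q')) + if q = q' then x * (1 / q : ℝ) else 0 := by
      intro q hq q' hq'
      by_cases h : q = q'
      · subst h
        simp only [and_self, if_true]
        rw [hmult]
        have : ((x / q : ℕ) : ℝ) ≤ x / q := Nat.cast_div_le
        have h0 : 0 ≤ (x : ℝ) * (1 / q * (1 / q)) := by positivity
        rw [mul_one_div (x : ℝ)]
        linarith
      · rw [if_neg h, add_zero]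
        have hc : q.Coprime q' := (Nat.coprime_primes (hP q hq) (hP q' hq')).2 h
        have : ∀ n, (q ∣ n ∧ q' ∣ n) ↔ q * q' ∣ n := fun n =>
          ⟨fun h => hc.mul_dvd_of_dvd_of_dvd h.1 h.2,
            fun h => ⟨dvd_of_mul_right_dvd h, dvd_of_mul_left_dvd h⟩⟩
        simp_rw [this]
        rw [hmult]
        refine Nat.cast_div_le.trans (le_of_eq ?_)
        push_cast
        rw [one_div_mul_one_div, mul_one_div]
    refine (Finset.sum_le_sum fun q hq => Finset.sum_le_sum (hb q hq)).trans (le_of_eq ?_)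
    simp_rw [Finset.sum_add_distrib, ← Finset.mul_sum, ← Finset.sum_mul]
    rw [← hL, sq]
    congr 1
    rw [hL, Finset.mul_sum]
    refine Finset.sum_congr rfl fun q hq => ?_
    rw [Finset.sum_ite_eq, if_pos hq]
  have h3 : ∑ n ∈ Finset.Icc 1 x, (((P.filter (· ∣ n)).card : ℝ) - L) ^ 2 =
      ∑ n ∈ Finset.Icc 1 x, ((P.filter (· ∣ n)).card : ℝ) ^ 2 -
        2 * L * ∑ n ∈ Finset.Icc 1 x, ((P.filter (· ∣ n)).card : ℝ) + x * L ^ 2 := by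
    simp_rw [sub_sq]
    rw [Finset.sum_add_distrib, Finset.sum_sub_distrib, Finset.mul_sum, Finset.sum_const,
      Nat.card_Icc, nsmul_eq_mul]
    congr 2
    exact Finset.sum_congr rfl fun n _ => by ring
  rw [h3]
  nlinarith

/-- The Turán–Kubilius inequality, twisted by a completely multiplicative function. -/
theorem abs_sum_mul_partialSum_div_sub_le {f : ℕ → ℝ} (hf : ∀ n, |f n| ≤ 1)
    (hmul : ∀ m n, f (m * n) = f m * f n) {P : Finset ℕ} {x : ℕ} (hP : ∀ q ∈ P, q.Prime)
    (hPx : ∀ q ∈ P, q ≤ x) :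
    |∑ q ∈ P, f q * partialSum f (x / q) - (∑ q ∈ P, (1 / q : ℝ)) * partialSum f x| ≤
      x * √(3 * ∑ q ∈ P, (1 / q : ℝ)) := by
  have hTK := sum_sq_card_dvd_sub_le hP hPx
  set L : ℝ := ∑ q ∈ P, (1 / q : ℝ) with hL
  have e : ∑ q ∈ P, f q * partialSum f (x / q) - L * partialSum f x =
      ∑ n ∈ Finset.Icc 1 x, f n * (((P.filter (· ∣ n)).card : ℝ) - L) := by
    simp_rw [mul_sub]
    rw [Finset.sum_sub_distrib, ← Finset.sum_mul, mul_comm L, partialSum]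
    congr 1
    rw [← Finset.sum_congr rfl fun q hq => sum_multiples_eq_partialSum hmul (hP q hq).pos x]
    simp_rw [Finset.sum_filter]
    rw [Finset.sum_comm]
    refine Finset.sum_congr rfl fun n _ => ?_
    rw [← Finset.sum_filter, Finset.sum_const, nsmul_eq_mul, mul_comm]
  rw [e]
  have hL0 : 0 ≤ L := Finset.sum_nonneg fun q _ => by positivity
  refine abs_le_of_sq_le_sq ?_ (by positivity)
  refine (Finset.sum_mul_sq_le_sq_mul_sq _ _ _).trans ?_
  have h1 : ∑ n ∈ Finset.Icc 1 x, f n ^ 2 ≤ x := by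
    calc ∑ n ∈ Finset.Icc 1 x, f n ^ 2 ≤ ∑ n ∈ Finset.Icc 1 x, (1 : ℝ) :=
          Finset.sum_le_sum fun n _ => (sq_le_one_iff_abs_le_one _).2 (hf n)
      _ = x := by simp
  rw [mul_pow, Real.sq_sqrt (by positivity)]
  calc _ ≤ (x : ℝ) * (3 * x * L) :=
        mul_le_mul h1 hTK (Finset.sum_nonneg fun n _ => sq_nonneg _) (by positivity)
    _ = _ := by ring

theorem sum_abs_partialSum_div_le {f : ℕ → ℝ} (hf : ∀ n, |f n| ≤ 1)
    (hmul : ∀ m n, f (m * n) = f m * f n) {P : Finset ℕ} {x : ℕ} (hP : ∀ q ∈ P, q.Prime)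
    (hPx : ∀ q ∈ P, q ≤ x) (hP1 : ∀ q ∈ P, |f q| = 1) {τ L : ℝ} (hx : |partialSum f x| ≤ τ * x)
    (hL : ∑ q ∈ P, (1 / q : ℝ) ≤ L) :
    ∑ q ∈ P, |partialSum f (x / q)| ≤ 2 * x * (√(3 * L) + L * τ) := by
  have key : ∀ T ⊆ P, |∑ q ∈ T, f q * partialSum f (x / q)| ≤ x * (√(3 * L) + L * τ) := by
    intro T hT
    have h := abs_sum_mul_partialSum_div_sub_le hf hmul (fun q hq => hP q (hT hq))
      (fun q hq => hPx q (hT hq))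
    have hTL : ∑ q ∈ T, (1 / q : ℝ) ≤ L :=
      (Finset.sum_le_sum_of_subset_of_nonneg hT fun q _ _ => by positivity).trans hL
    set LT : ℝ := ∑ q ∈ T, (1 / q : ℝ) with hLT
    have hLT0 : 0 ≤ LT := Finset.sum_nonneg fun q _ => by positivity
    have h1 : √(3 * LT) ≤ √(3 * L) := Real.sqrt_le_sqrt (by linarith)
    have h2 := abs_sub_abs_le_abs_sub (∑ q ∈ T, f q * partialSum f (x / q)) (LT * partialSum f x)
    rw [abs_mul, abs_of_nonneg hLT0] at h2
    have h3 : LT * |partialSum f x| ≤ L * (τ * x) :=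
      mul_le_mul hTL hx (abs_nonneg _) (hLT0.trans hTL)
    have h4 : (x : ℝ) * √(3 * LT) ≤ x * √(3 * L) := by gcongr
    linarith
  have hpos := key _ (P.filter_subset fun q => 0 ≤ f q * partialSum f (x / q))
  have hneg := key _ (P.filter_subset fun q => ¬ 0 ≤ f q * partialSum f (x / q))
  have e : ∀ q ∈ P, |partialSum f (x / q)| = |f q * partialSum f (x / q)| := by
    intro q hq
    rw [abs_mul, hP1 q hq, one_mul]
  rw [Finset.sum_congr rfl e,
    ← Finset.sum_filter_add_sum_filter_not P fun q => 0 ≤ f q * partialSum f (x / q)]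
  have e1 : ∑ q ∈ P with 0 ≤ f q * partialSum f (x / q), |f q * partialSum f (x / q)| =
      ∑ q ∈ P with 0 ≤ f q * partialSum f (x / q), f q * partialSum f (x / q) :=
    Finset.sum_congr rfl fun q hq => abs_of_nonneg (Finset.mem_filter.1 hq).2
  have e2 : ∑ q ∈ P with ¬ 0 ≤ f q * partialSum f (x / q), |f q * partialSum f (x / q)| =
      -∑ q ∈ P with ¬ 0 ≤ f q * partialSum f (x / q), f q * partialSum f (x / q) := by
    rw [← Finset.sum_neg_distrib]
    exact Finset.sum_congr rfl fun q hq => abs_of_neg (not_le.1 (Finset.mem_filter.1 hq).2)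
  rw [e1, e2]
  rw [abs_le] at hpos hneg
  linarith [hpos.2, hneg.1]

theorem sum_Ico_mul_div (g : ℕ → ℝ) (q : ℕ) {a b : ℕ} (hab : a ≤ b) :
    ∑ y ∈ Finset.Ico (q * a) (q * b), g (y / q) = q * ∑ u ∈ Finset.Ico a b, g u := by
  induction b, hab using Nat.le_induction with
  | base => simp
  | succ b hab ih =>
    rw [Finset.sum_Ico_succ_top hab, mul_add (q : ℝ), ← ih,
      ← Finset.sum_Ico_consecutive _ (Nat.mul_le_mul_left q hab)
        (Nat.mul_le_mul_left q (Nat.le_succ b))]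
    congr 1
    have : ∀ y ∈ Finset.Ico (q * b) (q * (b + 1)), g (y / q) = g b := by
      intro y hy
      rw [Finset.mem_Ico] at hy
      congr 1
      exact Nat.div_eq_of_lt_le (by linarith [hy.1, mul_comm q b])
        (by linarith [hy.2, mul_comm q (b + 1)])
    rw [Finset.sum_congr rfl this, Finset.sum_const, Nat.card_Ico, nsmul_eq_mul, mul_add, mul_one,
      Nat.add_sub_cancel_left]

/-- The sum of the absolute values of the partial sums of `f` over `[4 ^ v, 4 ^ (v + 1))`. -/
noncomputable def blockSum (f : ℕ → ℝ) (v : ℕ) : ℝ :=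
  ∑ u ∈ Finset.Ico (4 ^ v) (4 ^ (v + 1)), |partialSum f u|

theorem blockSum_nonneg (f : ℕ → ℝ) (v : ℕ) : 0 ≤ blockSum f v :=
  Finset.sum_nonneg fun _ _ => abs_nonneg _

theorem mul_blockSum_le (f : ℕ → ℝ) {q k : ℕ} (v : ℕ) (h1 : 4 ^ k ≤ q) (h2 : q < 4 ^ (k + 1)) :
    q * blockSum f v ≤ ∑ y ∈ Finset.Ico (4 ^ (k + v)) (4 ^ (k + v + 2)), |partialSum f (y / q)| := by
  rw [blockSum, ← sum_Ico_mul_div (fun u => |partialSum f u|) q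
    (Nat.pow_le_pow_right (by norm_num) (Nat.le_succ v))]
  refine Finset.sum_le_sum_of_subset_of_nonneg (Finset.Ico_subset_Ico ?_ ?_)
    fun _ _ _ => abs_nonneg _
  · rw [pow_add]; exact Nat.mul_le_mul_right _ h1
  · rw [show k + v + 2 = (k + 1) + (v + 1) by ring, pow_add 4 (k + 1)]
    exact Nat.mul_le_mul_right _ h2.le

theorem sum_abs_partialSum_div_le_blockSum (f : ℕ → ℝ) {q k v x H : ℕ} (h1 : 4 ^ k ≤ q)
    (h2 : q < 4 ^ (k + 1)) (hx : 4 ^ (k + v + 1) ≤ x) (hx' : x < 4 ^ (k + v + 2)) (hH : H ≤ x) :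
    ∑ y ∈ Finset.Ico x (x + H), |partialSum f (y / q)| ≤
      q * (blockSum f v + blockSum f (v + 1) + blockSum f (v + 2)) := by
  have hmono : ∀ i, 4 ^ i ≤ 4 ^ (i + 1) := fun i => Nat.pow_le_pow_right (by norm_num) (Nat.le_succ i)
  rw [blockSum, blockSum, blockSum, Finset.sum_Ico_consecutive _ (hmono v) (hmono (v + 1)),
    Finset.sum_Ico_consecutive _ ((hmono v).trans (hmono (v + 1))) (hmono (v + 2)),
    ← sum_Ico_mul_div (fun u => |partialSum f u|) q
      (((hmono v).trans (hmono (v + 1))).trans (hmono (v + 2)))]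
  refine Finset.sum_le_sum_of_subset_of_nonneg (Finset.Ico_subset_Ico ?_ ?_)
    fun _ _ _ => abs_nonneg _
  · refine le_trans ?_ hx
    rw [show k + v + 1 = (k + 1) + v by ring, pow_add 4 (k + 1)]
    exact Nat.mul_le_mul_right _ h2.le
  · have h3 : 4 ^ (k + v + 3) ≤ q * 4 ^ (v + 2 + 1) := by
      rw [show k + v + 3 = k + (v + 2 + 1) by ring, pow_add 4 k]
      exact Nat.mul_le_mul_right _ h1
    have h4 : 4 ^ (k + v + 3) = 4 ^ (k + v + 2) * 4 := pow_succ _ _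
    omega

/-- A set of `⌊4 ^ k / (4 * k)⌋` primes in `[4 ^ k, 4 ^ (k + 1))`, for `k ≥ 7`. -/
noncomputable def primeBlock (k : ℕ) : Finset ℕ :=
  if h : 7 ≤ k then (exists_primes_card_eq h).choose else ∅

theorem mem_primeBlock {k q : ℕ} (hq : q ∈ primeBlock k) :
    q.Prime ∧ 4 ^ k ≤ q ∧ q < 4 ^ (k + 1) := by
  rw [primeBlock] at hq
  split_ifs at hq with h
  · exact (exists_primes_card_eq h).choose_spec.2 q hq
  · simp at hq

theorem card_primeBlock {k : ℕ} (hk : 7 ≤ k) : (primeBlock k).card = 4 ^ k / (4 * k) := by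
  rw [primeBlock, dif_pos hk]
  exact (exists_primes_card_eq hk).choose_spec.1

/-- The normalised cardinality of `primeBlock k`. -/
noncomputable def blockWeight (k : ℕ) : ℝ := (primeBlock k).card / 4 ^ k

theorem blockWeight_nonneg (k : ℕ) : 0 ≤ blockWeight k := by
  rw [blockWeight]; positivity

theorem card_primeBlock_eq (k : ℕ) : ((primeBlock k).card : ℝ) = blockWeight k * 4 ^ k := by
  rw [blockWeight]; field_simp

theorem one_div_le_blockWeight {k : ℕ} (hk : 7 ≤ k) : 1 / (8 * k : ℝ) ≤ blockWeight k := by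
  have h := le_mul_card_of_eq_div hk (card_primeBlock hk)
  have hk0 : (0 : ℝ) < k := by exact_mod_cast (by omega : 0 < k)
  rw [blockWeight, div_le_div_iff₀ (by positivity) (by positivity)]
  have : (4 : ℝ) ^ k ≤ 8 * k * (primeBlock k).card := by exact_mod_cast h
  linarith

theorem blockWeight_le_one_div {k : ℕ} (hk : 7 ≤ k) : blockWeight k ≤ 1 / (4 * k : ℝ) := by
  have hk0 : (0 : ℝ) < k := by exact_mod_cast (by omega : 0 < k)
  have h : (primeBlock k).card * (4 * k) ≤ 4 ^ k := by
    rw [card_primeBlock hk]; exact Nat.div_mul_le_self _ _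
  rw [blockWeight, div_le_div_iff₀ (by positivity) (by positivity)]
  have : ((primeBlock k).card : ℝ) * (4 * k) ≤ 4 ^ k := by exact_mod_cast h
  linarith

theorem pairwiseDisjoint_primeBlock (s : Set ℕ) : s.PairwiseDisjoint primeBlock := by
  intro i _ j _ hij
  rw [Function.onFun, Finset.disjoint_left]
  intro q hi hj
  apply hij
  have h1 := mem_primeBlock hi
  have h2 := mem_primeBlock hj
  rw [← Nat.log_eq_of_pow_le_of_lt_pow h1.2.1 h1.2.2,
    ← Nat.log_eq_of_pow_le_of_lt_pow h2.2.1 h2.2.2]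

/-- The union of the prime blocks with index in `[a, b)`. -/
noncomputable def primeBlocks (a b : ℕ) : Finset ℕ := (Finset.Ico a b).biUnion primeBlock

theorem sum_primeBlocks (a b : ℕ) (g : ℕ → ℝ) :
    ∑ q ∈ primeBlocks a b, g q = ∑ k ∈ Finset.Ico a b, ∑ q ∈ primeBlock k, g q :=
  Finset.sum_biUnion (pairwiseDisjoint_primeBlock _)

theorem mem_primeBlocks {a b q : ℕ} (hq : q ∈ primeBlocks a b) : q.Prime ∧ q < 4 ^ b := by
  rw [primeBlocks, Finset.mem_biUnion] at hq
  obtain ⟨k, hk, hq⟩ := hq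
  have h := mem_primeBlock hq
  refine ⟨h.1, h.2.2.trans_le (Nat.pow_le_pow_right (by norm_num) ?_)⟩
  exact (Finset.mem_Ico.1 hk).2

theorem sum_one_div_primeBlocks_le (a b : ℕ) :
    ∑ q ∈ primeBlocks a b, (1 / q : ℝ) ≤ ∑ k ∈ Finset.Ico a b, blockWeight k := by
  rw [sum_primeBlocks]
  refine Finset.sum_le_sum fun k _ => ?_
  rw [blockWeight, div_eq_mul_one_div, ← nsmul_eq_mul]
  refine Finset.sum_le_card_nsmul _ _ _ fun q hq => ?_
  have : (4 : ℝ) ^ k ≤ q := by exact_mod_cast (mem_primeBlock hq).2.1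
  exact one_div_le_one_div_of_le (by positivity) this

theorem le_sum_one_div_primeBlocks (a b : ℕ) :
    (∑ k ∈ Finset.Ico a b, blockWeight k) / 4 ≤ ∑ q ∈ primeBlocks a b, (1 / q : ℝ) := by
  rw [sum_primeBlocks, Finset.sum_div]
  refine Finset.sum_le_sum fun k _ => ?_
  rw [blockWeight, div_div, ← pow_succ, div_eq_mul_one_div, ← nsmul_eq_mul]
  refine Finset.card_nsmul_le_sum _ _ _ fun q hq => ?_
  have h := mem_primeBlock hq
  have h0 : (0 : ℝ) < q := by exact_mod_cast h.1.pos
  have : (q : ℝ) ≤ 4 ^ (k + 1) := by exact_mod_cast h.2.2.le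
  exact one_div_le_one_div_of_le h0 this

theorem sum_blockWeight_mul_blockSum_le {f : ℕ → ℝ} (hf : ∀ n, |f n| ≤ 1)
    (hmul : ∀ m n, f (m * n) = f m * f n) {a b m : ℕ} (hbm : b ≤ m)
    (hf1 : ∀ q, q.Prime → q < 4 ^ b → |f q| = 1) {τ W : ℝ} (hτ : 0 ≤ τ)
    (hS : ∀ y, 4 ^ m ≤ y → y < 4 ^ (m + 2) → |partialSum f y| ≤ τ * y)
    (hW : ∑ k ∈ Finset.Ico a b, blockWeight k ≤ W) :
    ∑ k ∈ Finset.Ico a b, blockWeight k * (blockSum f (m - k) / 16 ^ (m - k)) ≤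
      480 * (√(3 * W) + W * τ) := by
  have hW0 : 0 ≤ W := (Finset.sum_nonneg fun k _ => blockWeight_nonneg k).trans hW
  have h16 : (0 : ℝ) < 16 ^ m := by positivity
  refine le_of_mul_le_mul_right ?_ h16
  rw [Finset.sum_mul]
  have h1 : ∀ k ∈ Finset.Ico a b,
      blockWeight k * (blockSum f (m - k) / 16 ^ (m - k)) * 16 ^ m ≤
        ∑ q ∈ primeBlock k, ∑ y ∈ Finset.Ico (4 ^ m) (4 ^ (m + 2)), |partialSum f (y / q)| := by
    intro k hk
    rw [Finset.mem_Ico] at hk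
    have hkm : k + (m - k) = m := by omega
    have e : blockWeight k * (blockSum f (m - k) / 16 ^ (m - k)) * 16 ^ m =
        (primeBlock k).card * (4 ^ k * blockSum f (m - k)) := by
      rw [card_primeBlock_eq]
      nth_rewrite 3 [← hkm]
      rw [pow_add, show (16 : ℝ) ^ k = 4 ^ k * 4 ^ k by rw [← mul_pow]; norm_num]
      field_simp
    rw [e, ← nsmul_eq_mul]
    refine Finset.card_nsmul_le_sum _ _ _ fun q hq => ?_
    have h := mem_primeBlock hq
    have h2 := mul_blockSum_le f (m - k) h.2.1 h.2.2
    rw [hkm] at h2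
    refine le_trans ?_ h2
    have : (4 : ℝ) ^ k ≤ q := by exact_mod_cast h.2.1
    exact mul_le_mul_of_nonneg_right this (blockSum_nonneg _ _)
  refine (Finset.sum_le_sum h1).trans ?_
  rw [← sum_primeBlocks a b
    (fun q => ∑ y ∈ Finset.Ico (4 ^ m) (4 ^ (m + 2)), |partialSum f (y / q)|), Finset.sum_comm]
  have h2 : ∀ y ∈ Finset.Ico (4 ^ m) (4 ^ (m + 2)),
      ∑ q ∈ primeBlocks a b, |partialSum f (y / q)| ≤ 32 * 4 ^ m * (√(3 * W) + W * τ) := by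
    intro y hy
    rw [Finset.mem_Ico] at hy
    have hby : 4 ^ b ≤ y := (Nat.pow_le_pow_right (by norm_num) hbm).trans hy.1
    refine (sum_abs_partialSum_div_le hf hmul (fun q hq => (mem_primeBlocks hq).1)
      (fun q hq => (mem_primeBlocks hq).2.le.trans hby)
      (fun q hq => hf1 q (mem_primeBlocks hq).1 (mem_primeBlocks hq).2) (hS y hy.1 hy.2)
      ((sum_one_div_primeBlocks_le a b).trans hW)).trans ?_
    have : (y : ℝ) ≤ 4 ^ (m + 2) := by exact_mod_cast hy.2.le
    rw [pow_add] at this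
    refine mul_le_mul_of_nonneg_right (by linarith) (by positivity)
  refine (Finset.sum_le_card_nsmul _ _ _ h2).trans (le_of_eq ?_)
  rw [nsmul_eq_mul, Nat.card_Ico, Nat.cast_sub (Nat.pow_le_pow_right (by norm_num) (by omega))]
  push_cast
  rw [pow_add, show (16 : ℝ) ^ m = 4 ^ m * 4 ^ m by rw [← mul_pow]; norm_num]
  ring

theorem mul_abs_partialSum_le {f : ℕ → ℝ} (hf : ∀ n, |f n| ≤ 1)
    (hmul : ∀ m n, f (m * n) = f m * f n) {a b h x H : ℕ} (hbh : b ≤ h)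
    (hx : 4 ^ h ≤ x) (hx' : x < 4 ^ (h + 1)) (hH : H ≤ x) {L : ℝ}
    (hL : ∑ q ∈ primeBlocks a b, (1 / q : ℝ) = L) :
    H * L * |partialSum f x| ≤ L * H ^ 2 + 2 * H * x * √(3 * L) +
      64 * x ^ 2 * ∑ k ∈ Finset.Ico a b, blockWeight k *
        (blockSum f (h - k - 1) / 16 ^ (h - k - 1) + blockSum f (h - k) / 16 ^ (h - k) +
          blockSum f (h - k + 1) / 16 ^ (h - k + 1)) := by
  have hL0 : 0 ≤ L := hL ▸ Finset.sum_nonneg fun q _ => by positivity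
  have h1 : ∀ y ∈ Finset.Ico x (x + H), L * |partialSum f x| ≤ L * H + 2 * x * √(3 * L) +
      ∑ q ∈ primeBlocks a b, |partialSum f (y / q)| := by
    intro y hy
    rw [Finset.mem_Ico] at hy
    obtain ⟨t, rfl⟩ := Nat.exists_eq_add_of_le hy.1
    have h2 := abs_partialSum_add_sub_le hf x t
    have hbx : 4 ^ b ≤ x := (Nat.pow_le_pow_right (by norm_num) hbh).trans hx
    have h3 := abs_sum_mul_partialSum_div_sub_le hf hmul (P := primeBlocks a b) (x := x + t)
      (fun q hq => (mem_primeBlocks hq).1)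
      (fun q hq => (mem_primeBlocks hq).2.le.trans (by omega))
    rw [hL] at h3
    have h4 : |∑ q ∈ primeBlocks a b, f q * partialSum f ((x + t) / q)| ≤
        ∑ q ∈ primeBlocks a b, |partialSum f ((x + t) / q)| := by
      refine (Finset.abs_sum_le_sum_abs _ _).trans (Finset.sum_le_sum fun q _ => ?_)
      rw [abs_mul]
      exact mul_le_of_le_one_left (abs_nonneg _) (hf q)
    have h5 : |L * partialSum f (x + t)| ≤ |∑ q ∈ primeBlocks a b, f q * partialSum f ((x + t) / q)|
        + (x + t : ℕ) * √(3 * L) := by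
      rw [abs_sub_comm] at h3
      linarith [abs_sub_abs_le_abs_sub (L * partialSum f (x + t))
        (∑ q ∈ primeBlocks a b, f q * partialSum f ((x + t) / q))]
    rw [abs_mul, abs_of_nonneg hL0] at h5
    have h6 : |partialSum f x| ≤ |partialSum f (x + t)| + t := by
      rw [abs_sub_comm] at h2
      linarith [abs_sub_abs_le_abs_sub (partialSum f x) (partialSum f (x + t))]
    have ht : (t : ℝ) ≤ H := by exact_mod_cast (by omega : t ≤ H)
    have hHx : (H : ℝ) ≤ x := by exact_mod_cast hH
    have h7 : L * |partialSum f x| ≤ L * (|partialSum f (x + t)| + H) :=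
      mul_le_mul_of_nonneg_left (by linarith) hL0
    have h8 : ((x + t : ℕ) : ℝ) * √(3 * L) ≤ 2 * x * √(3 * L) := by
      push_cast
      exact mul_le_mul_of_nonneg_right (by linarith) (Real.sqrt_nonneg _)
    linarith
  have h2 := Finset.card_nsmul_le_sum _ _ _ h1
  rw [Nat.card_Ico, Nat.add_sub_cancel_left, nsmul_eq_mul, Finset.sum_add_distrib, Finset.sum_const,
    Nat.card_Ico, Nat.add_sub_cancel_left, nsmul_eq_mul, Finset.sum_comm, sum_primeBlocks] at h2
  have h3 : ∀ k ∈ Finset.Ico a b,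
      ∑ q ∈ primeBlock k, ∑ y ∈ Finset.Ico x (x + H), |partialSum f (y / q)| ≤
        64 * x ^ 2 * (blockWeight k *
          (blockSum f (h - k - 1) / 16 ^ (h - k - 1) + blockSum f (h - k) / 16 ^ (h - k) +
            blockSum f (h - k + 1) / 16 ^ (h - k + 1))) := by
    intro k hk
    rw [Finset.mem_Ico] at hk
    obtain ⟨v, rfl⟩ : ∃ v, h = k + v + 1 := ⟨h - k - 1, by omega⟩
    rw [show k + v + 1 - k - 1 = v by omega, show k + v + 1 - k = v + 1 by omega,
      show v + 1 + 1 = v + 2 by omega]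
    have hb : ∀ q ∈ primeBlock k, ∑ y ∈ Finset.Ico x (x + H), |partialSum f (y / q)| ≤
        4 ^ (k + 1) * (blockSum f v + blockSum f (v + 1) + blockSum f (v + 2)) := by
      intro q hq
      have hq := mem_primeBlock hq
      refine (sum_abs_partialSum_div_le_blockSum f hq.2.1 hq.2.2 hx hx' hH).trans ?_
      have : (q : ℝ) ≤ 4 ^ (k + 1) := by exact_mod_cast hq.2.2.le
      refine mul_le_mul_of_nonneg_right this ?_
      linarith [blockSum_nonneg f v, blockSum_nonneg f (v + 1), blockSum_nonneg f (v + 2)]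
    refine (Finset.sum_le_card_nsmul _ _ _ hb).trans ?_
    rw [nsmul_eq_mul, card_primeBlock_eq]
    have hs : ∀ i ≤ 2, blockSum f (v + i) ≤ 16 ^ (v + 2) * (blockSum f (v + i) / 16 ^ (v + i)) := by
      intro i hi
      rw [mul_div_assoc', le_div_iff₀ (by positivity), mul_comm]
      refine mul_le_mul_of_nonneg_right ?_ (blockSum_nonneg _ _)
      exact pow_le_pow_right₀ (by norm_num) (by omega)
    have hs0 := hs 0 (by norm_num)
    rw [add_zero] at hs0
    have hs1 := hs 1 (by norm_num)
    have hs2 := hs 2 (by norm_num)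
    set M : ℝ := blockSum f v / 16 ^ v + blockSum f (v + 1) / 16 ^ (v + 1) +
      blockSum f (v + 2) / 16 ^ (v + 2) with hM
    have hM0 : 0 ≤ M := by
      have := blockSum_nonneg f
      have h0 := this v
      have h1 := this (v + 1)
      have h2 := this (v + 2)
      positivity
    have hxx : (4 : ℝ) ^ (k + v + 1) ≤ x := by exact_mod_cast hx
    have hw := blockWeight_nonneg k
    calc blockWeight k * 4 ^ k * (4 ^ (k + 1) * (blockSum f v + blockSum f (v + 1) +
          blockSum f (v + 2)))
        ≤ blockWeight k * 4 ^ k * (4 ^ (k + 1) * (16 ^ (v + 2) * M)) := by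
          have : blockSum f v + blockSum f (v + 1) + blockSum f (v + 2) ≤ 16 ^ (v + 2) * M := by
            rw [hM, mul_add, mul_add]; linarith
          gcongr
      _ = 64 * (4 ^ (k + v + 1)) ^ 2 * (blockWeight k * M) := by
          rw [show (16 : ℝ) ^ (v + 2) = 4 ^ (v + 2) * 4 ^ (v + 2) by rw [← mul_pow]; norm_num]
          ring
      _ ≤ 64 * x ^ 2 * (blockWeight k * M) := by gcongr
  have h4 := Finset.sum_le_sum h3
  rw [← Finset.mul_sum] at h4
  refine le_trans (le_of_eq ?_) (h2.trans (le_trans (add_le_add_right h4 _) (le_of_eq ?_)))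
  · ring
  · ring

theorem sum_blockWeight_double {d : ℕ} (hd : 7 ≤ d) :
    1 / 16 ≤ ∑ k ∈ Finset.Ico d (2 * d), blockWeight k ∧
      ∑ k ∈ Finset.Ico d (2 * d), blockWeight k ≤ 1 / 4 := by
  have hd0 : (0 : ℝ) < d := by exact_mod_cast (by omega : 0 < d)
  have hc : (Finset.Ico d (2 * d)).card = d := by rw [Nat.card_Ico]; omega
  constructor
  · have h : ∀ k ∈ Finset.Ico d (2 * d), 1 / (16 * d : ℝ) ≤ blockWeight k := by
      intro k hk
      rw [Finset.mem_Ico] at hk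
      refine le_trans ?_ (one_div_le_blockWeight (hd.trans hk.1))
      have h1 : (k : ℝ) ≤ 2 * d := by exact_mod_cast hk.2.le
      have h2 : (0 : ℝ) < k := by exact_mod_cast (by omega : 0 < k)
      exact one_div_le_one_div_of_le (by positivity) (by linarith)
    refine le_trans (le_of_eq ?_) (Finset.card_nsmul_le_sum _ _ _ h)
    rw [hc, nsmul_eq_mul]
    field_simp
  · have h : ∀ k ∈ Finset.Ico d (2 * d), blockWeight k ≤ 1 / (4 * d : ℝ) := by
      intro k hk
      rw [Finset.mem_Ico] at hk
      refine (blockWeight_le_one_div (hd.trans hk.1)).trans ?_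
      have h1 : (d : ℝ) ≤ k := by exact_mod_cast hk.1
      exact one_div_le_one_div_of_le (by positivity) (by linarith)
    refine (Finset.sum_le_card_nsmul _ _ _ h).trans (le_of_eq ?_)
    rw [hc, nsmul_eq_mul]
    field_simp

theorem sum_blockWeight_two_pow {d : ℕ} (hd : 7 ≤ d) (J : ℕ) :
    (J : ℝ) / 16 ≤ ∑ k ∈ Finset.Ico d (2 ^ J * d), blockWeight k ∧
      ∑ k ∈ Finset.Ico d (2 ^ J * d), blockWeight k ≤ (J : ℝ) / 4 := by
  induction J with
  | zero => simp
  | succ J ih =>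
    have h1 : d ≤ 2 ^ J * d := Nat.le_mul_of_pos_left _ (by positivity)
    have h2 := sum_blockWeight_double (hd.trans h1)
    have e : 2 ^ (J + 1) * d = 2 * (2 ^ J * d) := by ring
    rw [e, ← Finset.sum_Ico_consecutive _ h1 (by omega)]
    push_cast
    constructor <;> linarith [h2.1, h2.2, ih.1, ih.2]

theorem sum_blockWeight_mul_shift_le {α : ℕ → ℝ} (hα : ∀ v, 0 ≤ α v) {d c b b' m : ℕ}
    (hd : 7 ≤ d) (hc : c ≤ 2 * d) (hb : b + c ≤ b') :
    ∑ k ∈ Finset.Ico d b, blockWeight k * α (m - (k + c)) ≤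
      6 * ∑ k ∈ Finset.Ico d b', blockWeight k * α (m - k) := by
  have h1 : ∀ k ∈ Finset.Ico d b, blockWeight k * α (m - (k + c)) ≤
      6 * (blockWeight (k + c) * α (m - (k + c))) := by
    intro k hk
    rw [Finset.mem_Ico] at hk
    rw [← mul_assoc]
    refine mul_le_mul_of_nonneg_right ?_ (hα _)
    have h2 := blockWeight_le_one_div (hd.trans hk.1)
    have h3 := one_div_le_blockWeight (k := k + c) (by omega)
    have hk0 : (0 : ℝ) < k := by exact_mod_cast (by omega : 0 < k)
    have hck : (c : ℝ) ≤ 2 * k := by exact_mod_cast (by omega : c ≤ 2 * k)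
    have h4 : 1 / (4 * k : ℝ) ≤ 6 * (1 / (8 * ((k + c : ℕ) : ℝ))) := by
      push_cast
      rw [mul_one_div, div_le_div_iff₀ (by positivity) (by positivity)]
      linarith
    linarith
  refine (Finset.sum_le_sum h1).trans ?_
  rw [← Finset.mul_sum, Finset.sum_Ico_add' (fun k => blockWeight k * α (m - k))]
  refine mul_le_mul_of_nonneg_left ?_ (by norm_num)
  exact Finset.sum_le_sum_of_subset_of_nonneg (Finset.Ico_subset_Ico (by omega) hb)
    fun k _ _ => mul_nonneg (blockWeight_nonneg k) (hα _)

theorem mul_abs_partialSum_le_of_forall_le {f : ℕ → ℝ} (hf : ∀ n, |f n| ≤ 1)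
    (hmul : ∀ m n, f (m * n) = f m * f n) {J d h x H : ℕ} (hJ : 1 ≤ J) (hd : 7 ≤ d)
    (hdh : 2 ^ (J + 1) * d ≤ h) (hx : 4 ^ h ≤ x) (hx' : x < 4 ^ (h + 1)) (hH : H ≤ x)
    (hf1 : ∀ q, q.Prime → q < 4 ^ h → |f q| = 1) {τ : ℝ} (hτ : 0 ≤ τ)
    (hS : ∀ y, 4 ^ (h + d) ≤ y → y < 4 ^ (h + d + 2) → |partialSum f y| ≤ τ * y) :
    ∃ L : ℝ, (J : ℝ) / 64 ≤ L ∧ L ≤ J / 4 ∧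
      H * L * |partialSum f x| ≤ L * H ^ 2 + 2 * H * x * √J + 552960 * x ^ 2 * (2 * √J + J * τ) := by
  obtain ⟨hw1, hw2⟩ := sum_blockWeight_two_pow hd J
  obtain ⟨-, hW⟩ := sum_blockWeight_two_pow hd (J + 1)
  have hJ' : (1 : ℝ) ≤ J := by exact_mod_cast hJ
  have hdb : 2 * d ≤ 2 ^ J * d :=
    Nat.mul_le_mul_right _ (by simpa using Nat.pow_le_pow_right (n := 2) (by norm_num) hJ)
  have e : 2 ^ (J + 1) * d = 2 * (2 ^ J * d) := by ring
  set b := 2 ^ J * d with hb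
  rw [e] at hdh hW
  set α : ℕ → ℝ := fun v => blockSum f v / 16 ^ v with hα
  have hα0 : ∀ v, 0 ≤ α v := fun v => div_nonneg (blockSum_nonneg f v) (by positivity)
  have hlow := sum_blockWeight_mul_blockSum_le hf hmul (a := d) (b := 2 * b) (m := h + d)
    (by omega)
    (fun q hq hq' => hf1 q hq (hq'.trans_le (Nat.pow_le_pow_right (by norm_num) hdh))) hτ hS hW
  have hup := mul_abs_partialSum_le hf hmul (a := d) (b := b) (by omega) hx hx' hH rfl
  have h1 := le_sum_one_div_primeBlocks d b
  have h2 := sum_one_div_primeBlocks_le d b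
  set L := ∑ q ∈ primeBlocks d b, (1 / q : ℝ) with hL
  refine ⟨L, by linarith, by linarith, hup.trans ?_⟩
  have hsJ : √(3 * L) ≤ √J := Real.sqrt_le_sqrt (by linarith)
  have hsW : √(3 * (((J + 1 : ℕ) : ℝ) / 4)) ≤ 2 * √J := by
    rw [show 2 * √(J : ℝ) = √(4 * J) by
      rw [Real.sqrt_mul (by norm_num), show (4 : ℝ) = 2 ^ 2 by norm_num,
        Real.sqrt_sq (by norm_num)]]
    refine Real.sqrt_le_sqrt ?_
    push_cast
    linarith
  have hWτ : ((J + 1 : ℕ) : ℝ) / 4 * τ ≤ J * τ := by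
    push_cast
    exact mul_le_mul_of_nonneg_right (by linarith) hτ
  have hsum : ∑ k ∈ Finset.Ico d b, blockWeight k *
      (blockSum f (h - k - 1) / 16 ^ (h - k - 1) + blockSum f (h - k) / 16 ^ (h - k) +
        blockSum f (h - k + 1) / 16 ^ (h - k + 1)) ≤ 8640 * (2 * √J + J * τ) := by
    have e1 : ∑ k ∈ Finset.Ico d b, blockWeight k *
        (blockSum f (h - k - 1) / 16 ^ (h - k - 1) + blockSum f (h - k) / 16 ^ (h - k) +
          blockSum f (h - k + 1) / 16 ^ (h - k + 1)) =
        ∑ k ∈ Finset.Ico d b, blockWeight k * α (h + d - (k + (d + 1))) +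
        ∑ k ∈ Finset.Ico d b, blockWeight k * α (h + d - (k + d)) +
        ∑ k ∈ Finset.Ico d b, blockWeight k * α (h + d - (k + (d - 1))) := by
      rw [← Finset.sum_add_distrib, ← Finset.sum_add_distrib]
      refine Finset.sum_congr rfl fun k hk => ?_
      rw [Finset.mem_Ico] at hk
      rw [show h + d - (k + (d + 1)) = h - k - 1 by omega, show h + d - (k + d) = h - k by omega,
        show h + d - (k + (d - 1)) = h - k + 1 by omega, mul_add, mul_add]
    rw [e1]
    have s1 := sum_blockWeight_mul_shift_le hα0 (b := b) (b' := 2 * b) (m := h + d) (c := d + 1) hd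
      (by omega) (by omega)
    have s2 := sum_blockWeight_mul_shift_le hα0 (b := b) (b' := 2 * b) (m := h + d) (c := d) hd
      (by omega) (by omega)
    have s3 := sum_blockWeight_mul_shift_le hα0 (b := b) (b' := 2 * b) (m := h + d) (c := d - 1) hd
      (by omega) (by omega)
    have s4 : ∑ k ∈ Finset.Ico d (2 * b), blockWeight k * α (h + d - k) ≤
      480 * (2 * √J + J * τ) := hlow.trans (by linarith)
    linarith
  have h3 : 2 * (H : ℝ) * x * √(3 * L) ≤ 2 * H * x * √J := by gcongr
  have h4 := mul_le_mul_of_nonneg_left hsum (show 0 ≤ 64 * (x : ℝ) ^ 2 by positivity)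
  linarith

/-- If the mean values of a completely multiplicative function are tiny on a short interval
slightly beyond `x`, then they are already small at `x`. -/
theorem exists_forall_abs_partialSum_le {ε : ℝ} (hε : 0 < ε) (hε1 : ε ≤ 1) :
    ∃ J : ℕ, 1 ≤ J ∧ ∃ τ : ℝ, 0 < τ ∧ ∀ f : ℕ → ℝ, (∀ n, |f n| ≤ 1) →
      (∀ m n, f (m * n) = f m * f n) → ∀ d h x : ℕ, 7 ≤ d → 2 ^ (J + 1) * d ≤ h →
      4 ^ h ≤ x → x < 4 ^ (h + 1) → 8 ≤ ε * x →
      (∀ q, q.Prime → q < 4 ^ h → |f q| = 1) →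
      (∀ y, 4 ^ (h + d) ≤ y → y < 4 ^ (h + d + 2) → |partialSum f y| ≤ τ * y) →
      |partialSum f x| ≤ ε * x := by
  set C : ℝ := 552960 * 64 * 8 with hC
  obtain ⟨J, hJ⟩ := exists_nat_gt ((8 * C / ε ^ 2) ^ 2)
  have hC1 : 1 ≤ 8 * C / ε ^ 2 := by
    rw [le_div_iff₀ (by positivity), hC]
    nlinarith
  have hs : 8 * C / ε ^ 2 ≤ √J := Real.le_sqrt_of_sq_le hJ.le
  have hJ1 : 1 ≤ J := by
    have : (1 : ℝ) < J := lt_of_le_of_lt (one_le_pow₀ hC1) hJ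
    exact_mod_cast this.le
  refine ⟨J, hJ1, ε ^ 2 / (4 * C), by positivity, ?_⟩
  intro f hf hmul d h x hd hdh hx hx' hx8 hf1 hS
  have hx0 : (0 : ℝ) < x := by
    have : 0 < x := lt_of_lt_of_le (by positivity) hx
    exact_mod_cast this
  set τ := ε ^ 2 / (4 * C) with hτ
  have hH1 : ε / 8 * x ≤ (⌈ε / 8 * x⌉₊ : ℝ) := Nat.le_ceil _
  have hH2 : (⌈ε / 8 * x⌉₊ : ℝ) ≤ ε / 4 * x := by
    have := (Nat.ceil_lt_add_one (show 0 ≤ ε / 8 * x by positivity)).le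
    linarith
  set H := ⌈ε / 8 * x⌉₊ with hH
  have hHx : H ≤ x := by
    have : (H : ℝ) ≤ x := by nlinarith
    exact_mod_cast this
  have hH0 : (0 : ℝ) < H := lt_of_lt_of_le (by positivity) hH1
  obtain ⟨L, hL1, hL2, hmain⟩ := mul_abs_partialSum_le_of_forall_le hf hmul hJ1 hd hdh hx hx' hHx
    hf1 (by positivity) hS
  have hss : √(J : ℝ) * √J = J := Real.mul_self_sqrt (by positivity)
  set s := √(J : ℝ) with hsd
  rw [← hss] at hL1 hL2 hmain
  have hs1 : 1 ≤ s := hC1.trans hs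
  have hs0 : 0 < s := by linarith
  have hL0 : 0 < L := lt_of_lt_of_le (by positivity) hL1
  rw [div_le_iff₀ (by positivity)] at hs
  refine le_of_mul_le_mul_left (hmain.trans ?_) (mul_pos hH0 hL0)
  have t1 : L * H ^ 2 ≤ H * L * (ε / 4 * x) := by
    calc L * (H : ℝ) ^ 2 = H * L * H := by ring
      _ ≤ _ := by gcongr
  have t2 : 2 * H * x * s ≤ H * L * (ε / 4 * x) := by
    have : 512 ≤ s * ε := by
      have : s * ε ^ 2 ≤ s * ε := by
        apply mul_le_mul_of_nonneg_left _ hs0.le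
        nlinarith
      linarith
    have : 2 * s ≤ L * (ε / 4) := by
      calc 2 * s = 512 * s / 256 := by ring
        _ ≤ s * ε * s / 256 := by gcongr
        _ = s * s / 64 * (ε / 4) := by ring
        _ ≤ _ := by gcongr
    calc 2 * H * x * s = H * x * (2 * s) := by ring
      _ ≤ H * x * (L * (ε / 4)) := by gcongr
      _ = _ := by ring
  have t3 : 552960 * (x : ℝ) ^ 2 * (2 * s) ≤ H * L * (ε / 4 * x) := by
    calc 552960 * (x : ℝ) ^ 2 * (2 * s) = 8 * C * s / (8 * 64 * 4) * x * x := by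
          rw [hC]; ring
      _ ≤ s * ε ^ 2 * s / (8 * 64 * 4) * x * x := by gcongr
      _ ≤ ε / 8 * x * (s * s / 64) * (ε / 4 * x) := by
          have : 0 ≤ s * s * ε ^ 2 * x * x := by positivity
          linarith
      _ ≤ _ := by gcongr
  have t4 : 552960 * (x : ℝ) ^ 2 * (s * s * τ) ≤ H * L * (ε / 4 * x) := by
    calc 552960 * (x : ℝ) ^ 2 * (s * s * τ) = ε / 8 * x * (s * s / 64) * (ε / 4 * x) := by
          rw [hτ, hC]; field_simp
      _ ≤ _ := by gcongr
  linarith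

theorem two_mul_card_legendreSym_eq_neg_one {p : ℕ} [Fact p.Prime] {x : ℕ} (hx : x < p) :
    2 * (((Finset.Icc 1 x).filter fun n : ℕ => legendreSym p (n : ℤ) = -1).card : ℝ) =
      x - partialSum (fun n => (quadraticChar (ZMod p) (n : ZMod p) : ℝ)) x := by
  have h : ∀ n ∈ Finset.Icc 1 x, (quadraticChar (ZMod p) (n : ZMod p) : ℝ) =
      1 - 2 * if legendreSym p (n : ℤ) = -1 then (1 : ℝ) else 0 := by
    intro n hn
    rw [Finset.mem_Icc] at hn
    have h0 : (n : ZMod p) ≠ 0 := by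
      rw [Ne, ZMod.natCast_eq_zero_iff]
      exact Nat.not_dvd_of_pos_of_lt hn.1 (by omega)
    have e : legendreSym p (n : ℤ) = quadraticChar (ZMod p) (n : ZMod p) := by
      rw [legendreSym, Int.cast_natCast]
    rw [e]
    rcases quadraticChar_dichotomy h0 with h1 | h1 <;> rw [h1] <;> norm_num
  rw [partialSum, Finset.sum_congr rfl h, Finset.sum_sub_distrib, ← Finset.mul_sum,
    Finset.sum_boole]
  simp

open Filter in
theorem eventually_abs_partialSum_quadraticChar_floor_le {ε : ℝ} (hε : 0 < ε) (hε1 : ε ≤ 1) :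
    ∀ᶠ p : ℕ in atTop, ∀ _ : Fact p.Prime,
      |partialSum (fun n => (quadraticChar (ZMod p) (n : ZMod p) : ℝ)) ⌊(p : ℝ) ^ (1 / 4 : ℝ)⌋₊| ≤
        ε * ⌊(p : ℝ) ^ (1 / 4 : ℝ)⌋₊ := by
  obtain ⟨J, hJ, τ, hτ, hmain⟩ := exists_forall_abs_partialSum_le hε hε1
  set M := 2 ^ (J + 1) with hM
  have hM4 : 4 ≤ M := by
    simpa using Nat.pow_le_pow_right (n := 2) (by norm_num) (show 2 ≤ J + 1 by omega)
  have hM0 : (0 : ℝ) < M := by exact_mod_cast (by omega : 0 < M)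
  have hburgess := eventually_abs_partialSum_quadraticChar_le (δ := 1 / (16 * M))
    (τ := min (τ / 3) 1) (by positivity) (by positivity) (min_le_right _ _)
  have hX : Tendsto (fun p : ℕ => (p : ℝ) ^ (1 / 4 : ℝ)) atTop atTop :=
    (tendsto_rpow_atTop (by norm_num)).comp tendsto_natCast_atTop_atTop
  have ev1 := hX.eventually_ge_atTop ((4 : ℝ) ^ (7 * M))
  have ev2 := hX.eventually_ge_atTop (8 / ε + 1)
  filter_upwards [hburgess, ev1, ev2] with p hp h1 h2 hprime
  have hp1 : (1 : ℝ) ≤ p := by exact_mod_cast hprime.out.one_lt.le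
  have hp0 : (0 : ℝ) < p := by linarith
  have hxX : (⌊(p : ℝ) ^ (1 / 4 : ℝ)⌋₊ : ℝ) ≤ (p : ℝ) ^ (1 / 4 : ℝ) := Nat.floor_le (by positivity)
  have hXx : (p : ℝ) ^ (1 / 4 : ℝ) < ⌊(p : ℝ) ^ (1 / 4 : ℝ)⌋₊ + 1 := Nat.lt_floor_add_one _
  have hxM : 4 ^ (7 * M) ≤ ⌊(p : ℝ) ^ (1 / 4 : ℝ)⌋₊ := Nat.le_floor (by exact_mod_cast h1)
  have hxp : (⌊(p : ℝ) ^ (1 / 4 : ℝ)⌋₊ : ℝ) ≤ p := hxX.trans (by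
    calc (p : ℝ) ^ (1 / 4 : ℝ) ≤ (p : ℝ) ^ (1 : ℝ) :=
          Real.rpow_le_rpow_of_exponent_le hp1 (by norm_num)
      _ = p := Real.rpow_one _)
  have e1 : (p : ℝ) ^ (1 / 4 + 1 / (16 * M) : ℝ) =
      ((p : ℝ) ^ (1 / 4 : ℝ)) ^ (1 + 1 / (4 * M) : ℝ) := by
    rw [← Real.rpow_mul hp0.le]
    congr 1
    field_simp
    ring
  have e2 : (p : ℝ) ^ (3 / 8 : ℝ) = ((p : ℝ) ^ (1 / 4 : ℝ)) ^ (3 / 2 : ℝ) := by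
    rw [← Real.rpow_mul hp0.le]
    norm_num
  rw [e1, e2] at hp
  generalize (p : ℝ) ^ (1 / 4 : ℝ) = X at *
  set x := ⌊X⌋₊ with hx
  have hx0 : x ≠ 0 := by
    have : 0 < 4 ^ (7 * M) := by positivity
    omega
  set h := Nat.log 4 x with hh
  have hh1 : 4 ^ h ≤ x := Nat.pow_log_le_self 4 hx0
  have hh2 : x < 4 ^ (h + 1) := Nat.lt_pow_succ_log_self (by norm_num) x
  have hhM : 7 * M ≤ h := Nat.le_log_of_pow_le (by norm_num) hxM
  set d := h / M with hd
  have hd7 : 7 ≤ d := (Nat.le_div_iff_mul_le (by omega)).2 hhM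
  have hMd : M * d ≤ h := Nat.mul_div_le h M
  have hMd' : h + 1 ≤ M * (d + 1) := Nat.lt_mul_div_succ h (by omega)
  have hX0 : 0 ≤ X := by linarith [Nat.cast_nonneg (α := ℝ) x]
  have hX4 : X ≤ (4 : ℝ) ^ ((h + 1 : ℕ) : ℝ) := by
    rw [Real.rpow_natCast]
    have : ((x + 1 : ℕ) : ℝ) ≤ ((4 ^ (h + 1) : ℕ) : ℝ) := Nat.cast_le.2 hh2
    push_cast at this
    linarith
  have hX4' : (4 : ℝ) ^ (h : ℝ) ≤ X := by
    rw [Real.rpow_natCast]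
    have : ((4 ^ h : ℕ) : ℝ) ≤ x := Nat.cast_le.2 hh1
    push_cast at this
    linarith
  have hlow : X ^ (1 + 1 / (4 * M) : ℝ) ≤ (4 : ℝ) ^ (h + d) := by
    calc X ^ (1 + 1 / (4 * M) : ℝ) ≤ ((4 : ℝ) ^ ((h + 1 : ℕ) : ℝ)) ^ (1 + 1 / (4 * M) : ℝ) :=
          Real.rpow_le_rpow hX0 hX4 (by positivity)
      _ = (4 : ℝ) ^ (((h + 1 : ℕ) : ℝ) * (1 + 1 / (4 * M) : ℝ)) := by
          rw [← Real.rpow_mul (by norm_num)]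
      _ ≤ (4 : ℝ) ^ ((h + d : ℕ) : ℝ) := by
          refine Real.rpow_le_rpow_of_exponent_le (by norm_num) ?_
          have h3 : ((h + 1 : ℕ) : ℝ) ≤ M * (d + 1) := by exact_mod_cast hMd'
          have h4 : ((h + 1 : ℕ) : ℝ) * (1 / (4 * M)) ≤ (d + 1) / 4 := by
            rw [mul_one_div, div_le_div_iff₀ (by positivity) (by positivity)]
            linarith
          have h5 : (7 : ℝ) ≤ d := by exact_mod_cast hd7
          rw [mul_add, mul_one]
          push_cast at h4 ⊢
          linarith
      _ = _ := Real.rpow_natCast _ _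
  have hhigh : (4 : ℝ) ^ (h + d + 2) ≤ X ^ (3 / 2 : ℝ) := by
    calc (4 : ℝ) ^ (h + d + 2) = (4 : ℝ) ^ ((h + d + 2 : ℕ) : ℝ) := (Real.rpow_natCast _ _).symm
      _ ≤ (4 : ℝ) ^ ((h : ℝ) * (3 / 2)) := by
          refine Real.rpow_le_rpow_of_exponent_le (by norm_num) ?_
          have h3 : 4 * d ≤ h := (Nat.mul_le_mul_right d hM4).trans hMd
          have h4 : (4 : ℝ) * d ≤ h := by exact_mod_cast h3
          have h5 : (7 : ℝ) ≤ d := by exact_mod_cast hd7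
          push_cast
          linarith
      _ = ((4 : ℝ) ^ (h : ℝ)) ^ (3 / 2 : ℝ) := Real.rpow_mul (by norm_num) _ _
      _ ≤ _ := Real.rpow_le_rpow (by positivity) hX4' (by norm_num)
  refine hmain _ (fun n => abs_quadraticChar_le_one _) (fun m n => ?_) d h x hd7 hMd hh1 hh2 ?_ ?_ ?_
  · push_cast
    rw [map_mul]
    push_cast
    rfl
  · have : 8 / ε ≤ x := by linarith
    rw [div_le_iff₀ hε] at this
    linarith
  · intro q hq hqh
    have hqp : q < p := by
      have : x ≤ p := by exact_mod_cast hxp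
      omega
    have h0 : (q : ZMod p) ≠ 0 := by
      rw [Ne, ZMod.natCast_eq_zero_iff]
      exact Nat.not_dvd_of_pos_of_lt hq.pos hqp
    rcases quadraticChar_dichotomy h0 with h1 | h1 <;> simp only [h1] <;> norm_num
  · intro y hy1 hy2
    have hy1' : (4 : ℝ) ^ (h + d) ≤ y := by exact_mod_cast hy1
    have hy2' : (y : ℝ) ≤ 4 ^ (h + d + 2) := by exact_mod_cast hy2.le
    refine (hp hprime y (hlow.trans hy1') (hy2'.trans hhigh)).trans ?_
    refine mul_le_mul_of_nonneg_right ?_ (Nat.cast_nonneg _)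
    linarith [min_le_left (τ / 3) 1]

/-- For every ε > 0, for all sufficiently large primes p,
#{1 ≤ n ≤ p^{1/4} : (n|p) = −1} = (1/2 + o(1))·p^{1/4}. -/
theorem nonresidue_count_quarter_power
    (ε : ℝ) (hε : 0 < ε) :
    ∃ p₀ : ℕ, ∀ p : ℕ, p₀ ≤ p → ∀ hp : p.Prime,
      abs (((((Finset.Icc 1 ⌊(p : ℝ) ^ ((1 : ℝ) / 4)⌋₊).filter
            (fun n : ℕ => @legendreSym p ⟨hp⟩ (n : ℤ) = -1)).card : ℝ) -
          (1 / 2) * (p : ℝ) ^ ((1 : ℝ) / 4))) ≤ ε * (p : ℝ) ^ ((1 : ℝ) / 4) := by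
  have hX : Filter.Tendsto (fun p : ℕ => (p : ℝ) ^ (1 / 4 : ℝ)) Filter.atTop Filter.atTop :=
    (tendsto_rpow_atTop (by norm_num)).comp tendsto_natCast_atTop_atTop
  obtain ⟨p₀, hp₀⟩ := Filter.eventually_atTop.1
    ((eventually_abs_partialSum_quadraticChar_floor_le (ε := min ε 1) (by positivity)
      (min_le_right _ _)).and ((hX.eventually_ge_atTop (1 / ε)).and (Filter.eventually_gt_atTop 1)))
  refine ⟨p₀, fun p hpp hp => ?_⟩
  obtain ⟨h1, h2, h3⟩ := hp₀ p hpp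
  have : Fact p.Prime := ⟨hp⟩
  have hS := h1 ⟨hp⟩
  have hp1 : (1 : ℝ) < p := by exact_mod_cast h3
  have hxp : ⌊(p : ℝ) ^ ((1 : ℝ) / 4)⌋₊ < p := by
    rw [Nat.floor_lt (by positivity)]
    calc (p : ℝ) ^ ((1 : ℝ) / 4) < (p : ℝ) ^ (1 : ℝ) :=
          Real.rpow_lt_rpow_of_exponent_lt hp1 (by norm_num)
      _ = p := Real.rpow_one _
  have hcount := two_mul_card_legendreSym_eq_neg_one hxp
  have hxX : (⌊(p : ℝ) ^ ((1 : ℝ) / 4)⌋₊ : ℝ) ≤ (p : ℝ) ^ ((1 : ℝ) / 4) :=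
    Nat.floor_le (by positivity)
  have hXx : (p : ℝ) ^ ((1 : ℝ) / 4) < ⌊(p : ℝ) ^ ((1 : ℝ) / 4)⌋₊ + 1 := Nat.lt_floor_add_one _
  rw [div_le_iff₀ hε] at h2
  have h4 : min ε 1 * (⌊(p : ℝ) ^ ((1 : ℝ) / 4)⌋₊ : ℝ) ≤ ε * (p : ℝ) ^ ((1 : ℝ) / 4) :=
    mul_le_mul (min_le_left _ _) hxX (Nat.cast_nonneg _) hε.le
  have h5 := abs_le.1 (hS.trans h4)
  rw [abs_le]
  constructor <;> linarith [h5.1, h5.2]
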